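/- (Necessary condition for solvability of the strong inverse variational problem.) Let ω be an n-form on ℝ^{2n+1} with χ ⌟ ω = 0 and let L be a smooth function on ℝ^{2n+1}. Suppose the Euler–Lagrange equation of the first-order Lagrangian L coincides with the Monge–Ampère equation Δ_ωφ = 0, in the sense that there exists a nowhere-vanishing smooth function k on ℝ^{2n+1} with (j¹φ)*(ω − k·E(Lβ)) = 0 for every smooth φ: ℝⁿ → ℝ. Then the effective part of ω satisfies ω_ε = k·E(Lβ). -/

import Mathlib

noncomputable section

namespace MA

/-- Points / tangent vectors of ℝ^m. -/
abbrev Vec (m : ℕ) := Fin m → ℝ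

/-- An (unbundled) differential `k`-form on ℝ^m : at each point it eats a
`k`-tuple of tangent vectors and returns a real number. -/
abbrev Form (m k : ℕ) := Vec m → (Fin k → Vec m) → ℝ

/-- `ω` is pointwise an alternating multilinear map, i.e. a genuine exterior form. -/
def IsForm {m k : ℕ} (ω : Form m k) : Prop :=
  ∀ x : Vec m, ∃ a : AlternatingMap ℝ (Vec m) ℝ (Fin k), ∀ v, ω x v = a v

/-- Smoothness of a differential form (smoothness of all coefficients). -/
def SmoothForm {m k : ℕ} (ω : Form m k) : Prop :=
  ∀ v : Fin k → Vec m, ContDiff ℝ (⊤ : ℕ∞) fun x => ω x v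

/-- Multiplication of a form by a scalar function. -/
def fsmul {m k : ℕ} (f : Vec m → ℝ) (ω : Form m k) : Form m k := fun x v => f x * ω x v

/-- Wedge (exterior) product of differential forms. -/
def wedge {m k l : ℕ} (ω : Form m k) (η : Form m l) : Form m (k + l) := fun x v =>
  ((k.factorial * l.factorial : ℕ) : ℝ)⁻¹ *
    ∑ σ : Equiv.Perm (Fin (k + l)),
      ((Equiv.Perm.sign σ : ℤ) : ℝ) *
        (ω x fun i => v (σ (Fin.castAdd l i))) *
        (η x fun j => v (σ (Fin.natAdd k j)))

/-- Interior product (contraction) of a form with a (constant) vector. -/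
def iprod {m : ℕ} (u : Vec m) : ∀ {k : ℕ}, Form m k → Form m (k - 1)
  | 0, _ => 0
  | _ + 1, ω => fun x v => ω x (Fin.cons u v)

/-- Exterior derivative of a differential form (coordinate formula). -/
def exd {m k : ℕ} (ω : Form m k) : Form m (k + 1) := fun x v =>
  ∑ i : Fin (k + 1),
    (-1 : ℝ) ^ (i : ℕ) * fderiv ℝ (fun y => ω y fun j => v (i.succAbove j)) x (v i)

/-- Change the (propositionally equal) degree of a form. -/
def reindex {m k l : ℕ} (h : k = l) (ω : Form m k) : Form m l :=
  fun x v => ω x fun i => v (Fin.cast h i)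

/-- Pullback of a differential form along a map. -/
def pullback {a b k : ℕ} (f : Vec a → Vec b) (ω : Form b k) : Form a k :=
  fun x v => ω (f x) fun i => fderiv ℝ f x (v i)

/-- `i`-th standard basis vector of ℝ^m. -/
def basisVec {m : ℕ} (i : Fin m) : Vec m := Pi.single i 1

/-- The coordinate 1-form `dx^i`. -/
def dx {m : ℕ} (i : Fin m) : Form m 1 := fun _ v => v 0 i

/-- Partial derivative of a function in the `i`-th coordinate direction. -/
def pd {m : ℕ} (i : Fin m) (f : Vec m → ℝ) : Vec m → ℝ := fun x => fderiv ℝ f x (basisVec i)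

/- Jet-space coordinates on J¹ℝⁿ = ℝ^{2n+1} : (q¹,…,qⁿ,u,p₁,…,pₙ). -/

/-- Index of the coordinate `q^μ`. -/
def qIdx {n : ℕ} (μ : Fin n) : Fin (2 * n + 1) := ⟨μ, by have := μ.isLt; omega⟩

/-- Index of the coordinate `u`. -/
def uIdx {n : ℕ} : Fin (2 * n + 1) := ⟨n, by omega⟩

/-- Index of the coordinate `p_μ`. -/
def pIdx {n : ℕ} (μ : Fin n) : Fin (2 * n + 1) := ⟨n + 1 + μ, by have := μ.isLt; omega⟩

/-- The Reeb field `χ = ∂/∂u` (a constant vector field). -/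
def chi {n : ℕ} : Vec (2 * n + 1) := basisVec uIdx

/-- The standard contact form `c = du - Σ p_μ dq^μ` on J¹ℝⁿ. -/
def contact {n : ℕ} : Form (2 * n + 1) 1 := fun x v =>
  v 0 uIdx - ∑ μ : Fin n, x (pIdx μ) * v 0 (qIdx μ)

/-- The symplectic-type 2-form `Ω = dc = Σ dq^μ ∧ dp_μ`. -/
def symp {n : ℕ} : Form (2 * n + 1) 2 := ∑ μ : Fin n, wedge (dx (qIdx μ)) (dx (pIdx μ))

/-- The bottom operator `⊥ = Σ_μ ∂_{p_μ} ⌟ ∂_{q^μ} ⌟ ·` (zero on forms of degree ≤ 1). -/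
def botOp {n k : ℕ} (ω : Form (2 * n + 1) k) : Form (2 * n + 1) (k - 2) :=
  ∑ μ : Fin n, iprod (basisVec (pIdx μ)) (iprod (basisVec (qIdx μ)) ω)

/-- A form is effective if it is killed by `χ ⌟ ·` and by `⊥`. -/
def Effective {n k : ℕ} (ω : Form (2 * n + 1) k) : Prop :=
  iprod (chi (n := n)) ω = 0 ∧ botOp ω = 0

/-- The projection `p(α) = α - c ∧ (χ ⌟ α)` onto forms annihilated by `χ ⌟ ·`. -/
def proj {n : ℕ} : ∀ {k : ℕ}, Form (2 * n + 1) k → Form (2 * n + 1) k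
  | 0, α => α
  | j + 1, α => α - reindex (Nat.add_comm 1 j) (wedge contact (iprod (chi (n := n)) α))

/-- The projected exterior derivative `d_p = p ∘ d`. -/
def dproj {n k : ℕ} (ω : Form (2 * n + 1) k) : Form (2 * n + 1) (k + 1) := proj (exd ω)

/-- Lie derivative along the (constant) Reeb field `χ`. -/
def lieChi {n k : ℕ} (ω : Form (2 * n + 1) k) : Form (2 * n + 1) k := fun x v =>
  fderiv ℝ (fun y => ω y v) x (chi (n := n))

/-- The Euler operator `E = d_p ∘ ⊥ ∘ d_p + L_χ` on n-forms over J¹ℝⁿ. -/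
def euler : ∀ {n : ℕ}, Form (2 * n + 1) n → Form (2 * n + 1) n
  | 0, ω => lieChi ω
  | n + 1, ω =>
    reindex (show n + 1 + 1 - 2 + 1 = n + 1 by omega) (dproj (botOp (dproj ω))) + lieChi ω

/-- The horizontal volume form `β = dq¹ ∧ … ∧ dqⁿ` on J¹ℝⁿ. -/
def qvol {n : ℕ} : Form (2 * n + 1) n := fun _ v =>
  Matrix.det (Matrix.of fun i j : Fin n => v i (qIdx j))

/-- The volume form `β = dq¹ ∧ … ∧ dqⁿ` on the base ℝⁿ. -/
def baseVol {n : ℕ} : Form n n := fun _ v => Matrix.det (Matrix.of fun i j : Fin n => v i j)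

/-- `β_μ = ∂_{q^μ} ⌟ β`. -/
def betaMu {n : ℕ} (μ : Fin n) : Form (2 * n + 1) (n - 1) := iprod (basisVec (qIdx μ)) qvol

/-- The first jet prolongation `j¹φ : ℝⁿ → ℝ^{2n+1}`, `x ↦ (x, φ(x), ∂₁φ(x), …, ∂ₙφ(x))`. -/
def jet {n : ℕ} (φ : Vec n → ℝ) (x : Vec n) : Vec (2 * n + 1) := fun i =>
  if h : (i : ℕ) < n then x ⟨i, h⟩
  else if h2 : (i : ℕ) = n then φ x
  else fderiv ℝ φ x (basisVec ⟨(i : ℕ) - (n + 1), by have := i.isLt; omega⟩)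

/-- Second partial derivative `φ_{μν} = ∂²φ/∂q^μ∂q^ν`. -/
def d2 {n : ℕ} (φ : Vec n → ℝ) (μ ν : Fin n) : Vec n → ℝ := fun x =>
  fderiv ℝ (fun y => fderiv ℝ φ y (basisVec ν)) x (basisVec μ)

/-- A form is multisymplectic if it is closed and pointwise nondegenerate. -/
def Multisymplectic {m k : ℕ} (μ : Form m k) : Prop :=
  exd μ = 0 ∧ ∀ (x v : Vec m), iprod v μ x = 0 → v = 0

/-- Lift a form on J¹ℝⁿ = ℝ^{2n+1} to ℝ^{2n+2} = J¹ℝⁿ × ℝ (extra coordinate `e`)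
along the projection. -/
def liftForm {n k : ℕ} (ω : Form (2 * n + 1) k) : Form (2 * n + 1 + 1) k :=
  pullback (fun y (i : Fin (2 * n + 1)) => y i.castSucc) ω

/-- The 1-form `de` on ℝ^{2n+2}. -/
def deForm {n : ℕ} : Form (2 * n + 1 + 1) 1 := dx (Fin.last (2 * n + 1))

/-- The (n+1)-form `m_ω = de ∧ β + c ∧ ω` on ℝ^{2n+2}. -/
def msf {n : ℕ} (ω : Form (2 * n + 1) n) : Form (2 * n + 1 + 1) (n + 1) :=
  reindex (Nat.add_comm 1 n) (wedge (deForm (n := n)) (liftForm qvol)) +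
    reindex (Nat.add_comm 1 n) (wedge (liftForm (contact (n := n))) (liftForm ω))

section Symplectic

variable {W ι : Type*} [AddCommGroup W] [Module ℝ W] [DecidableEq ι]

/-- Generators: the radical of `Ω` together with the vectors `q a`, `p a` for `a ∈ s`. -/
def symplecticGens (Ω : W →ₗ[ℝ] W →ₗ[ℝ] ℝ) (s : Finset ι) (q p : ι → W) : Set W :=
  {w | (∀ w', Ω w w' = 0) ∨ ∃ a ∈ s, w = q a ∨ w = p a}

/-- The families `q`, `p` are symplectic for `Ω` on the index set `s`. -/
structure IsSymplecticFamily (Ω : W →ₗ[ℝ] W →ₗ[ℝ] ℝ) (s : Finset ι) (q p : ι → W) : Prop where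
  qq : ∀ a ∈ s, ∀ b ∈ s, Ω (q a) (q b) = 0
  pp : ∀ a ∈ s, ∀ b ∈ s, Ω (p a) (p b) = 0
  qp : ∀ a ∈ s, ∀ b ∈ s, Ω (q a) (p b) = if a = b then 1 else 0

/-- If `η` vanishes on isotropic tuples of the span of `U`, and `U'` lies in the span of `U` and
is orthogonal to `e`, then `ι_e η` vanishes on isotropic tuples of the span of `U'`. -/
theorem curryLeft_isotropic {Ω : W →ₗ[ℝ] W →ₗ[ℝ] ℝ} (hΩ : ∀ x, Ω x x = 0)
    {k : ℕ} {η : W [⋀^Fin (k + 1)]→ₗ[ℝ] ℝ} {U U' : Set W} {e : W}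
    (h1 : ∀ v : Fin (k + 1) → W, (∀ i, v i ∈ Submodule.span ℝ U) →
      (∀ i j, Ω (v i) (v j) = 0) → η v = 0)
    (he : e ∈ Submodule.span ℝ U) (hU : ∀ w ∈ U', w ∈ Submodule.span ℝ U)
    (hort : ∀ w ∈ U', Ω e w = 0) :
    ∀ v : Fin k → W, (∀ i, v i ∈ Submodule.span ℝ U') →
      (∀ i j, Ω (v i) (v j) = 0) → η.curryLeft e v = 0 := by
  intro v hv hiso
  have hUU : Submodule.span ℝ U' ≤ Submodule.span ℝ U := Submodule.span_le.2 hU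
  have hor : ∀ i, Ω e (v i) = 0 := by
    intro i
    have : Submodule.span ℝ U' ≤ LinearMap.ker (Ω e) :=
      Submodule.span_le.2 fun w hw => by simpa using hort w hw
    simpa using this (hv i)
  have hneg : ∀ x y, Ω x y = - Ω y x := fun x y => by
    have := hΩ (x + y)
    simp only [map_add, LinearMap.add_apply, hΩ] at this
    linarith
  refine h1 _ ?_ ?_
  · intro i
    refine Fin.cases ?_ (fun i => ?_) i
    · simpa using he
    · simpa using hUU (hv i)
  · intro i j
    refine Fin.cases ?_ (fun i => ?_) i <;> refine Fin.cases ?_ (fun j => ?_) j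
    · simp [hΩ]
    · simp [hor]
    · simp [hneg _ e, hor]
    · simp [hiso]

theorem curryLeft_update_update {k : ℕ} (η : W [⋀^Fin (k + 1)]→ₗ[ℝ] ℝ) (e x y : W)
    (v : Fin k → W) (i j : Fin k) :
    η.curryLeft e (Function.update (Function.update v i x) j y) =
      η (Function.update (Function.update (Matrix.vecCons e v) i.succ x) j.succ y) := by
  rw [AlternatingMap.curryLeft_apply_apply]
  congr 1
  simp only [Matrix.vecCons, Fin.cons_update]

/-- An alternating form which vanishes on isotropic tuples and is killed by contraction with the
Poisson bivector `∑ q a ∧ p a` vanishes on the span of the generators. -/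
theorem eq_zero_of_isotropic_of_contraction (Ω : W →ₗ[ℝ] W →ₗ[ℝ] ℝ) (hΩ : ∀ x, Ω x x = 0)
    (k : ℕ) : ∀ (s : Finset ι) (q p : ι → W), IsSymplecticFamily Ω s q p →
    ∀ η : W [⋀^Fin k]→ₗ[ℝ] ℝ,
    (∀ v : Fin k → W, (∀ i, v i ∈ Submodule.span ℝ (symplecticGens Ω s q p)) →
      (∀ i j, Ω (v i) (v j) = 0) → η v = 0) →
    (∀ (v : Fin k → W) (i j : Fin k), i ≠ j →
      ∑ a ∈ s, η (Function.update (Function.update v i (q a)) j (p a)) = 0) →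
    ∀ v : Fin k → W, (∀ i, v i ∈ symplecticGens Ω s q p) → η v = 0 := by
  have hneg : ∀ x y, Ω x y = - Ω y x := fun x y => by
    have := hΩ (x + y)
    simp only [map_add, LinearMap.add_apply, hΩ] at this
    linarith
  induction k with
  | zero => intro s q p _ η h1 _ v _; exact h1 v (fun i => i.elim0) (fun i => i.elim0)
  | succ k ih =>
    intro s q p hs η h1 h2
    have hsub : ∀ w ∈ symplecticGens Ω s q p,
      w ∈ Submodule.span ℝ (symplecticGens Ω s q p) := fun w hw => Submodule.subset_span hw
    have hqU : ∀ a ∈ s, q a ∈ symplecticGens Ω s q p := fun a ha => Or.inr ⟨a, ha, Or.inl rfl⟩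
    have hpU : ∀ a ∈ s, p a ∈ symplecticGens Ω s q p := fun a ha => Or.inr ⟨a, ha, Or.inr rfl⟩
    -- reduction along a vector `e`
    have red : ∀ (e : W) (s' : Finset ι) (q' p' : ι → W), IsSymplecticFamily Ω s' q' p' →
        e ∈ Submodule.span ℝ (symplecticGens Ω s q p) →
        (∀ w ∈ symplecticGens Ω s' q' p', w ∈ Submodule.span ℝ (symplecticGens Ω s q p)) →
        (∀ w ∈ symplecticGens Ω s' q' p', Ω e w = 0) →
        (∀ (v : Fin (k + 1) → W) (i j : Fin k), i ≠ j → v 0 = e →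
          ∑ a ∈ s', η (Function.update (Function.update v i.succ (q' a)) j.succ (p' a)) = 0) →
        ∀ (v : Fin (k + 1) → W) (i : Fin (k + 1)), v i = e →
          (∀ l, l ≠ i → v l ∈ symplecticGens Ω s' q' p') → η v = 0 := by
      intro e s' q' p' hs' he hU hort hc v i hvi hv
      have h0 : ∀ w : Fin k → W, (∀ l, w l ∈ symplecticGens Ω s' q' p') →
          η.curryLeft e w = 0 := by
        refine ih s' q' p' hs' (η.curryLeft e) (curryLeft_isotropic hΩ h1 he hU hort) ?_
        intro v i j hij
        simp only [curryLeft_update_update]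
        exact hc _ i j hij rfl
      have h3 := h0 (i.removeNth v) (fun l => hv _ (Fin.succAbove_ne i l))
      rw [AlternatingMap.curryLeft_apply_apply] at h3
      have h4 := η.map_insertNth i e (i.removeNth v)
      rw [h3, ← hvi, Fin.insertNth_self_removeNth] at h4
      simpa using h4
    have hrad : ∀ r, (∀ w, Ω r w = 0) → ∀ (v : Fin (k + 1) → W) (i : Fin (k + 1)), v i = r →
        (∀ l, v l ∈ symplecticGens Ω s q p) → η v = 0 := by
      intro r hr v i hvi hv
      refine red r s q p hs (Submodule.subset_span (Or.inl hr)) hsub (fun w _ => hr w) ?_ v i hvi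
        (fun l _ => hv l)
      intro v i j hij _
      exact h2 v i.succ j.succ (by simpa using hij)
    have hmono : ∀ a, ∀ w ∈ symplecticGens Ω (s.erase a) q p, w ∈ symplecticGens Ω s q p := by
      rintro a w (hw | ⟨b, hb, hw⟩)
      · exact Or.inl hw
      · exact Or.inr ⟨b, Finset.mem_of_mem_erase hb, hw⟩
    have hfam : ∀ a, IsSymplecticFamily Ω (s.erase a) q p := fun a =>
      ⟨fun b hb c hc => hs.qq b (Finset.mem_of_mem_erase hb) c (Finset.mem_of_mem_erase hc),
       fun b hb c hc => hs.pp b (Finset.mem_of_mem_erase hb) c (Finset.mem_of_mem_erase hc),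
       fun b hb c hc => hs.qp b (Finset.mem_of_mem_erase hb) c (Finset.mem_of_mem_erase hc)⟩
    have hq : ∀ a ∈ s, ∀ (v : Fin (k + 1) → W) (i : Fin (k + 1)), v i = q a →
        (∀ l, l ≠ i → v l ∈ symplecticGens Ω (s.erase a) q p) → η v = 0 := by
      intro a ha
      refine red (q a) (s.erase a) q p (hfam a) (hsub _ (hqU a ha))
        (fun w hw => hsub _ (hmono a w hw)) ?_ ?_
      · rintro w (hw | ⟨b, hb, rfl | rfl⟩)
        · rw [hneg, hw, neg_zero]
        · exact hs.qq a ha b (Finset.mem_of_mem_erase hb)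
        · rw [hs.qp a ha b (Finset.mem_of_mem_erase hb), if_neg (Finset.ne_of_mem_erase hb).symm]
      · intro v i j hij hv
        rw [← h2 v i.succ j.succ (by simpa using hij), ← Finset.add_sum_erase s _ ha,
          eq_comm, add_eq_right]
        refine η.map_eq_zero_of_eq _ (i := 0) (j := i.succ) ?_ (Fin.succ_ne_zero i).symm
        rw [Function.update_of_ne (Fin.succ_ne_zero j).symm,
          Function.update_of_ne (Fin.succ_ne_zero i).symm,
          Function.update_of_ne (by simpa using hij), Function.update_self, hv]
    have hp : ∀ a ∈ s, ∀ (v : Fin (k + 1) → W) (i : Fin (k + 1)), v i = p a →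
        (∀ l, l ≠ i → v l ∈ symplecticGens Ω (s.erase a) q p) → η v = 0 := by
      intro a ha
      refine red (p a) (s.erase a) q p (hfam a) (hsub _ (hpU a ha))
        (fun w hw => hsub _ (hmono a w hw)) ?_ ?_
      · rintro w (hw | ⟨b, hb, rfl | rfl⟩)
        · rw [hneg, hw, neg_zero]
        · rw [hneg, hs.qp b (Finset.mem_of_mem_erase hb) a ha,
            if_neg (Finset.ne_of_mem_erase hb), neg_zero]
        · exact hs.pp a ha b (Finset.mem_of_mem_erase hb)
      · intro v i j hij hv
        rw [← h2 v i.succ j.succ (by simpa using hij), ← Finset.add_sum_erase s _ ha,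
          eq_comm, add_eq_right]
        refine η.map_eq_zero_of_eq _ (i := 0) (j := j.succ) ?_ (Fin.succ_ne_zero j).symm
        rw [Function.update_of_ne (Fin.succ_ne_zero j).symm,
          Function.update_of_ne (Fin.succ_ne_zero i).symm, Function.update_self, hv]
    have hpol : ∀ a ∈ s, ∀ b ∈ s, a ≠ b → ∀ (v : Fin (k + 1) → W) (i j : Fin (k + 1)), i ≠ j →
        v i = q a + q b → v j = p a - p b →
        (∀ l, l ≠ i → l ≠ j → v l ∈ symplecticGens Ω ((s.erase a).erase b) q p) → η v = 0 := by
      intro a ha b hb hab v i j hij hvi hvj hv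
      set p' := Function.update p b (p a - p b) with hp'
      set q' := Function.update q b (- q b) with hq'
      have hfam' : IsSymplecticFamily Ω (s.erase a) q' p' := by
        constructor
        all_goals
          intro c hc d hd
          have hca := Finset.ne_of_mem_erase hc
          have hda := Finset.ne_of_mem_erase hd
          have hc' := Finset.mem_of_mem_erase hc
          have hd' := Finset.mem_of_mem_erase hd
          have e1 := hs.qq
          have e2 := hs.pp
          have e3 := hs.qp
          by_cases hcb : c = b <;> by_cases hdb : d = b <;>
            simp [hq', hp', hcb, hdb, e1 _ hc' _ hd', e2 _ hc' _ hd', e3 _ hc' _ hd',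
              e1 _ hc' _ hb, e1 _ hb _ hd', e2 _ hc' _ hb, e2 _ hb _ hd', e2 _ ha _ hd',
              e2 _ hc' _ ha, e2 _ ha _ hb, e2 _ hb _ ha, e2 _ ha _ ha, e2 _ hb _ hb, e1 _ hb _ hb,
              e3 _ hc' _ hb, e3 _ hb _ hd', e3 _ hb _ hb, e3 _ hb _ ha, e3 _ hc' _ ha, hca,
              hab.symm, eq_comm (a := b) (b := d)]
      refine red (q a + q b) (s.erase a) q' p' hfam'
        (Submodule.add_mem _ (hsub _ (hqU a ha)) (hsub _ (hqU b hb))) ?_ ?_ ?_ v i hvi ?_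
      · rintro w (hw | ⟨c, hc, rfl | rfl⟩)
        · exact hsub _ (Or.inl hw)
        · by_cases hcb : c = b
          · subst hcb
            simpa [hq'] using hsub _ (hqU c hb)
          · simpa [hq', hcb] using hsub _ (hqU c (Finset.mem_of_mem_erase hc))
        · by_cases hcb : c = b
          · subst hcb
            simpa [hp'] using Submodule.sub_mem _ (hsub _ (hpU a ha)) (hsub _ (hpU c hb))
          · simpa [hp', hcb] using hsub _ (hpU c (Finset.mem_of_mem_erase hc))
      · rintro w (hw | ⟨c, hc, rfl | rfl⟩)
        · rw [hneg, hw, neg_zero]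
        · have hc' := Finset.mem_of_mem_erase hc
          by_cases hcb : c = b
          · simp [hcb, hq', hs.qq a ha b hb, hs.qq b hb b hb]
          · simp [hcb, hq', hs.qq a ha c hc', hs.qq b hb c hc']
        · have hc' := Finset.mem_of_mem_erase hc
          have hca := Finset.ne_of_mem_erase hc
          by_cases hcb : c = b
          · simp [hcb, hp', hs.qp a ha b hb, hs.qp b hb b hb, hs.qp a ha a ha, hs.qp b hb a ha,
              hab, hab.symm]
          · simp [hcb, hp', hs.qp a ha c hc', hs.qp b hb c hc', Ne.symm hcb, Ne.symm hca]
      · intro v i j hij hv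
        have hi : i.succ ≠ j.succ := by simpa using hij
        have hbe : b ∈ s.erase a := Finset.mem_erase.2 ⟨hab.symm, hb⟩
        rw [← h2 v i.succ j.succ hi, ← Finset.add_sum_erase s _ ha,
          ← Finset.add_sum_erase _ _ hbe, ← Finset.add_sum_erase _ _ hbe, ← add_assoc]
        congr 1
        · have hz : η (Function.update (Function.update v i.succ (q a + q b)) j.succ (p a)) = 0 := by
            refine η.map_eq_zero_of_eq _ (i := 0) (j := i.succ) ?_ (Fin.succ_ne_zero i).symm
            rw [Function.update_of_ne (Fin.succ_ne_zero j).symm,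
              Function.update_of_ne (Fin.succ_ne_zero i).symm,
              Function.update_of_ne hi, Function.update_self, hv]
          simp only [hq', hp', Function.update_self]
          rw [Function.update_comm hi] at hz
          rw [Function.update_comm hi, Function.update_comm hi, Function.update_comm hi]
          rw [η.map_update_add] at hz
          rw [η.map_update_neg, Function.update_comm hi.symm, η.map_update_sub,
            Function.update_comm hi, Function.update_comm hi]
          linarith
        · refine Finset.sum_congr rfl fun c hc => ?_
          have hcb := Finset.ne_of_mem_erase hc
          simp [hq', hp', hcb]
      · intro l hl
        by_cases hlj : l = j
        · subst hlj
          exact Or.inr ⟨b, Finset.mem_erase.2 ⟨hab.symm, hb⟩, Or.inr (by simp [hp', hvj])⟩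
        · rcases hv l hl hlj with h | ⟨c, hc, h⟩
          · exact Or.inl h
          · have hcb := Finset.ne_of_mem_erase hc
            exact Or.inr ⟨c, Finset.mem_of_mem_erase hc, by simpa [hq', hp', hcb] using h⟩
    intro v hv
    by_contra hne
    have hinj : ∀ i j, v i = v j → i = j := fun i j hij => by
      by_contra hn
      exact hne (η.map_eq_zero_of_eq v hij hn)
    have hv' : ∀ i, ∃ a ∈ s, v i = q a ∨ v i = p a := fun i => by
      rcases hv i with h | h
      · exact absurd (hrad _ h v i rfl hv) hne
      · exact h
    -- both `q a` and `p a` occur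
    have hpair : ∃ a ∈ s, ∃ i j, v i = q a ∧ v j = p a := by
      obtain ⟨a, ha, h | h⟩ := hv' 0
      · by_contra hcon
        push Not at hcon
        refine hne (hq a ha v 0 h fun l hl => ?_)
        obtain ⟨c, hc, h'⟩ := hv' l
        refine Or.inr ⟨c, Finset.mem_erase.2 ⟨?_, hc⟩, h'⟩
        rintro rfl
        rcases h' with h' | h'
        · exact hl (hinj _ _ (h'.trans h.symm))
        · exact hcon c hc 0 l h h'
      · by_contra hcon
        push Not at hcon
        refine hne (hp a ha v 0 h fun l hl => ?_)
        obtain ⟨c, hc, h'⟩ := hv' l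
        refine Or.inr ⟨c, Finset.mem_erase.2 ⟨?_, hc⟩, h'⟩
        rintro rfl
        rcases h' with h' | h'
        · exact hcon c hc l 0 h' h
        · exact hl (hinj _ _ (h'.trans h.symm))
    obtain ⟨a, ha, i, j, hi, hj⟩ := hpair
    have hij : i ≠ j := by
      rintro rfl
      have := hs.qp a ha a ha
      rw [← hj, hi, if_pos rfl, hΩ] at this
      norm_num at this
    classical
    have hterm : ∀ b ∈ s, η (Function.update (Function.update v i (q b)) j (p b)) =
        (if ∃ l, l ≠ i ∧ l ≠ j ∧ (v l = q b ∨ v l = p b) then 0 else 1) * η v := by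
      intro b hb
      split_ifs with hused
      · obtain ⟨l, hli, hlj, h | h⟩ := hused
        · rw [zero_mul]
          refine η.map_eq_zero_of_eq _ (i := l) (j := i) ?_ hli
          simp [hli, hlj, hij, h]
        · rw [zero_mul]
          refine η.map_eq_zero_of_eq _ (i := l) (j := j) ?_ hlj
          simp [hli, hlj, h]
      · rw [one_mul]
        push Not at hused
        by_cases hab : a = b
        · subst hab
          rw [← hi, ← hj, Function.update_eq_self, Function.update_eq_self]
        · have hrest : ∀ l, l ≠ i → l ≠ j → ∃ c ∈ s, c ≠ a ∧ c ≠ b ∧ (v l = q c ∨ v l = p c) := by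
            intro l hli hlj
            obtain ⟨c, hc, h⟩ := hv' l
            refine ⟨c, hc, ?_, ?_, h⟩
            · rintro rfl
              rcases h with h | h
              · exact hli (hinj _ _ (h.trans hi.symm))
              · exact hlj (hinj _ _ (h.trans hj.symm))
            · rintro rfl
              rcases h with h | h
              · exact (hused l hli hlj).1 h
              · exact (hused l hli hlj).2 h
          have key := hpol a ha b hb hab
            (Function.update (Function.update v i (q a + q b)) j (p a - p b)) i j hij
            (by simp [hij]) (by simp) (by
              intro l hli hlj
              obtain ⟨c, hc, hca, hcb, h⟩ := hrest l hli hlj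
              refine Or.inr ⟨c, by simp [hca, hcb, hc], ?_⟩
              simpa [hli, hlj] using h)
          have z1 : η (Function.update (Function.update v i (q a)) j (p b)) = 0 := by
            refine hq a ha _ i (by simp [hij]) fun l hl => ?_
            by_cases hlj : l = j
            · subst hlj
              exact Or.inr ⟨b, by simp [Ne.symm hab, hb], by simp⟩
            · obtain ⟨c, hc, hca, hcb, h⟩ := hrest l hl hlj
              exact Or.inr ⟨c, by simp [hca, hc], by simpa [hl, hlj] using h⟩
          have z2 : η (Function.update (Function.update v i (q b)) j (p a)) = 0 := by
            refine hq b hb _ i (by simp [hij]) fun l hl => ?_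
            by_cases hlj : l = j
            · subst hlj
              exact Or.inr ⟨a, by simp [hab, ha], by simp⟩
            · obtain ⟨c, hc, hca, hcb, h⟩ := hrest l hl hlj
              exact Or.inr ⟨c, by simp [hcb, hc], by simpa [hl, hlj] using h⟩
          have z3 : η (Function.update (Function.update v i (q a)) j (p a)) = η v := by
            rw [← hi, ← hj, Function.update_eq_self, Function.update_eq_self]
          rw [η.map_update_sub, Function.update_comm hij, Function.update_comm hij,
            η.map_update_add, η.map_update_add, ← Function.update_comm hij,
            ← Function.update_comm hij, ← Function.update_comm hij, ← Function.update_comm hij,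
            z1, z2, z3] at key
          linarith
    have hsum := h2 v i j hij
    rw [Finset.sum_congr rfl hterm, ← Finset.sum_mul] at hsum
    have hpos : (0 : ℝ) < ∑ b ∈ s,
        (if ∃ l, l ≠ i ∧ l ≠ j ∧ (v l = q b ∨ v l = p b) then (0 : ℝ) else 1) := by
      refine Finset.sum_pos' (fun b _ => by split_ifs <;> norm_num) ⟨a, ha, ?_⟩
      rw [if_neg]
      · norm_num
      · rintro ⟨l, hli, hlj, h | h⟩
        · exact hli (hinj _ _ (h.trans hi.symm))
        · exact hlj (hinj _ _ (h.trans hj.symm))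
    exact hne ((mul_eq_zero.1 hsum).resolve_left hpos.ne')

end Symplectic

theorem alternatingMap_sum_apply {V ι κ : Type*} [AddCommGroup V] [Module ℝ V] (s : Finset κ)
    (f : κ → V [⋀^ι]→ₗ[ℝ] ℝ) (v : ι → V) : (∑ d ∈ s, f d) v = ∑ d ∈ s, f d v := by
  classical
  induction s using Finset.induction_on with
  | empty => simp
  | insert a s ha ih => simp [Finset.sum_insert ha, ih]

theorem wedge_one_apply {m j : ℕ} {ω : Form m 1} {η : Form m j} {x : Vec m}
    (c : Vec m →ₗ[ℝ] ℝ) (α : Vec m [⋀^Fin j]→ₗ[ℝ] ℝ) (hω : ∀ v, ω x v = c (v 0))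
    (hη : ∀ v, η x v = α v) (v : Fin (j + 1) → Vec m) :
    reindex (Nat.add_comm 1 j) (wedge ω η) x v =
      ∑ i : Fin (j + 1), (-1 : ℝ) ^ (i : ℕ) * (c (v i) * α (i.removeNth v)) := by
  have h1 : reindex (Nat.add_comm 1 j) (wedge ω η) x v = ((j.factorial : ℕ) : ℝ)⁻¹ *
      ∑ σ : Equiv.Perm (Fin (j + 1)), ((Equiv.Perm.sign σ : ℤ) : ℝ) *
        (c (v (σ 0)) * α fun l => v (σ l.succ)) := by
    simp only [reindex, wedge, Nat.factorial_one, one_mul]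
    congr 1
    refine Fintype.sum_equiv (finCongr (Nat.add_comm 1 j)).permCongr _ _ fun σ => ?_
    rw [Equiv.Perm.sign_permCongr, hω, hη, mul_assoc]
    have h0 : ∀ y : Fin (1 + j), Fin.cast (Nat.add_comm 1 j) (σ y) =
        (finCongr (Nat.add_comm 1 j)).permCongr σ (Fin.cast (Nat.add_comm 1 j) y) := fun _ => rfl
    have hz : Fin.cast (Nat.add_comm 1 j) (Fin.castAdd j (0 : Fin 1)) = 0 := rfl
    have hs : ∀ l : Fin j, Fin.cast (Nat.add_comm 1 j) (Fin.natAdd 1 l) = l.succ := fun l => by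
      ext; simp
    simp only [h0, hz, hs]
  rw [h1, Finset.univ_perm_fin_succ, ← Finset.univ_product_univ]
  simp only [Finset.sum_map, Equiv.toEmbedding_apply, Finset.sum_product]
  rw [inv_mul_eq_iff_eq_mul₀ (by positivity), Finset.mul_sum]
  refine Finset.sum_congr rfl fun i _ => ?_
  have h2 : ∀ σ : Equiv.Perm (Fin j),
      (α fun l => v (Equiv.swap 0 i (σ l).succ)) =
        ((Equiv.Perm.sign σ : ℤ) : ℝ) * α fun l => v (Equiv.swap 0 i l.succ) := by
    intro σ
    have := α.map_perm (fun l => v (Equiv.swap 0 i l.succ)) σ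
    simpa [Function.comp_def, Units.smul_def] using this
  have h3 : (if i = 0 then 1 else -1 : ℝ) * (α fun l => v (Equiv.swap 0 i l.succ)) =
      (-1) ^ (i : ℕ) * α (i.removeNth v) := by
    refine Fin.cases ?_ (fun i => ?_) i
    · simp
      rfl
    · have := α.map_perm (i.succ.removeNth v) i.cycleRange
      rw [Fin.sign_cycleRange] at this
      have h4 : (i.succ.removeNth v ∘ i.cycleRange) = fun l => v (Equiv.swap 0 i.succ l.succ) := by
        funext l
        simp [Fin.removeNth, Fin.succAbove_cycleRange]
      rw [← h4, this]
      simp [Units.smul_def, pow_succ]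
  have h5 : ∀ σ : Equiv.Perm (Fin j), ((Equiv.Perm.sign σ : ℤ) : ℝ) *
      ((Equiv.Perm.sign σ : ℤ) : ℝ) = 1 := fun σ => by
    rw [← Int.cast_mul, ← Units.val_mul, Int.units_mul_self]; simp
  calc _ = ∑ σ : Equiv.Perm (Fin j), c (v i) * ((-1) ^ (i : ℕ) * α (i.removeNth v)) := by
        refine Finset.sum_congr rfl fun σ _ => ?_
        rw [Equiv.Perm.decomposeFin.symm_sign]
        simp only [Equiv.Perm.decomposeFin_symm_apply_zero,
          Equiv.Perm.decomposeFin_symm_apply_succ]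
        rw [h2, ← h3]
        push_cast
        have := h5 σ
        split_ifs <;> push_cast
        · linear_combination (c (v i) * (α fun l => v (Equiv.swap 0 i l.succ))) * this
        · linear_combination (-c (v i) * (α fun l => v (Equiv.swap 0 i l.succ))) * this
    _ = _ := by
        simp only [Finset.sum_const, Finset.card_univ, Fintype.card_perm, Fintype.card_fin,
          nsmul_eq_mul]
        ring

/-- The contact form at `x`, as a linear map. -/
def contactLin {n : ℕ} (x : Vec (2 * n + 1)) : Vec (2 * n + 1) →ₗ[ℝ] ℝ :=
  LinearMap.proj uIdx - ∑ μ : Fin n, x (pIdx μ) • LinearMap.proj (qIdx μ)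

theorem contact_eq {n : ℕ} (x : Vec (2 * n + 1)) (v : Fin 1 → Vec (2 * n + 1)) :
    contact x v = contactLin x (v 0) := by
  simp [contact, contactLin]

@[simp] theorem qIdx_inj {n : ℕ} (μ ν : Fin n) : qIdx μ = qIdx ν ↔ μ = ν := by
  simp [qIdx, Fin.ext_iff]

@[simp] theorem pIdx_inj {n : ℕ} (μ ν : Fin n) : pIdx μ = pIdx ν ↔ μ = ν := by
  simp [pIdx, Fin.ext_iff]

@[simp] theorem qIdx_ne_uIdx {n : ℕ} (μ : Fin n) : qIdx μ ≠ uIdx := by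
  simp [qIdx, uIdx, Fin.ext_iff, μ.isLt.ne]

@[simp] theorem pIdx_ne_uIdx {n : ℕ} (μ : Fin n) : pIdx μ ≠ uIdx := by
  simp only [pIdx, uIdx, ne_eq, Fin.ext_iff]; omega

@[simp] theorem qIdx_ne_pIdx {n : ℕ} (μ ν : Fin n) : qIdx μ ≠ pIdx ν := by
  simp only [pIdx, qIdx, ne_eq, Fin.ext_iff]; omega

@[simp] theorem pIdx_ne_qIdx {n : ℕ} (μ ν : Fin n) : pIdx μ ≠ qIdx ν := (qIdx_ne_pIdx ν μ).symm

@[simp] theorem uIdx_ne_qIdx {n : ℕ} (μ : Fin n) : uIdx ≠ qIdx μ := (qIdx_ne_uIdx μ).symm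

@[simp] theorem uIdx_ne_pIdx {n : ℕ} (μ : Fin n) : uIdx ≠ pIdx μ := (pIdx_ne_uIdx μ).symm

@[simp] theorem contactLin_chi {n : ℕ} (x : Vec (2 * n + 1)) : contactLin x chi = 1 := by
  simp [contactLin, chi, basisVec]

@[simp] theorem contactLin_basisVec_pIdx {n : ℕ} (x : Vec (2 * n + 1)) (ν : Fin n) :
    contactLin x (basisVec (pIdx ν)) = 0 := by
  simp [contactLin, basisVec]

/-- The differential of `f`, made horizontal by subtracting its Reeb component. -/
def horizDiff {n : ℕ} (f : Vec (2 * n + 1) → ℝ) (x : Vec (2 * n + 1)) :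
    Vec (2 * n + 1) →ₗ[ℝ] ℝ :=
  (fderiv ℝ f x : Vec (2 * n + 1) →ₗ[ℝ] ℝ) - fderiv ℝ f x chi • contactLin x

@[simp] theorem horizDiff_chi {n : ℕ} (f : Vec (2 * n + 1) → ℝ) (x : Vec (2 * n + 1)) :
    horizDiff f x chi = 0 := by
  simp [horizDiff]

@[simp] theorem horizDiff_basisVec_pIdx {n : ℕ} (f : Vec (2 * n + 1) → ℝ) (x : Vec (2 * n + 1))
    (ν : Fin n) : horizDiff f x (basisVec (pIdx ν)) = fderiv ℝ f x (basisVec (pIdx ν)) := by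
  simp [horizDiff]

/-- `d_p` of a form `∑ f_μ B_μ` with constant coefficients forms `B_μ` killed by `χ`. -/
theorem dproj_sum {n j : ℕ} {ι : Type*} [Fintype ι] (f : ι → Vec (2 * n + 1) → ℝ)
    (B : ι → Vec (2 * n + 1) [⋀^Fin j]→ₗ[ℝ] ℝ) (hf : ∀ μ, Differentiable ℝ (f μ))
    (hB : ∀ μ v i, v i = chi → B μ v = 0) (x : Vec (2 * n + 1))
    (v : Fin (j + 1) → Vec (2 * n + 1)) :
    dproj (fun y w => ∑ μ, f μ y * B μ w) x v =
      ∑ i : Fin (j + 1), (-1 : ℝ) ^ (i : ℕ) *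
        ∑ μ, horizDiff (f μ) x (v i) * B μ (i.removeNth v) := by
  set A : Vec (2 * n + 1) [⋀^Fin (j + 1)]→ₗ[ℝ] ℝ := AlternatingMap.alternatizeUncurryFin
    (∑ μ, (fderiv ℝ (f μ) x : Vec (2 * n + 1) →ₗ[ℝ] ℝ).smulRight (B μ)) with hA
  have hAv : ∀ w, A w = ∑ i : Fin (j + 1), (-1 : ℝ) ^ (i : ℕ) *
        ∑ μ, fderiv ℝ (f μ) x (w i) * B μ (i.removeNth w) := by
    intro w
    simp [hA, AlternatingMap.alternatizeUncurryFin_apply, LinearMap.sum_apply,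
      alternatingMap_sum_apply]
  have hex : ∀ w, exd (fun y w => ∑ μ, f μ y * B μ w) x w = A w := by
    intro w
    rw [hAv]
    refine Finset.sum_congr rfl fun i _ => ?_
    congr 1
    rw [fderiv_fun_sum (fun μ _ => ((hf μ).mul_const _).differentiableAt)]
    simp only [_root_.sum_apply]
    refine Finset.sum_congr rfl fun μ _ => ?_
    rw [fderiv_mul_const (hf μ).differentiableAt]
    simp only [smul_apply, smul_eq_mul]
    exact mul_comm _ _
  have hchi : ∀ w, A (Fin.cons chi w) = ∑ μ, fderiv ℝ (f μ) x chi * B μ w := by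
    intro w
    rw [hAv, Fin.sum_univ_succ]
    have : ∀ i : Fin j, ∀ μ, B μ (i.succ.removeNth
        (Fin.cons chi w : Fin (j + 1) → Vec (2 * n + 1))) = 0 := by
      intro i μ
      cases j with
      | zero => exact i.elim0
      | succ j => exact hB μ _ 0 (by simp [Fin.removeNth])
    simp [this]
  show exd _ x v - reindex (Nat.add_comm 1 j) (wedge contact (iprod chi (exd _))) x v = _
  rw [wedge_one_apply (contactLin x) (A.curryLeft chi) (contact_eq x) ?_, hex, hAv,
    ← Finset.sum_sub_distrib]
  · refine Finset.sum_congr rfl fun i _ => ?_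
    rw [AlternatingMap.curryLeft_apply_apply, Matrix.vecCons, hchi, ← mul_sub, Finset.mul_sum,
      ← Finset.sum_sub_distrib]
    congr 1
    refine Finset.sum_congr rfl fun μ _ => ?_
    simp [horizDiff]
    ring
  · intro w
    exact hex _

/-- `β` as an alternating map. -/
def qvolAlt (n : ℕ) : Vec (2 * n + 1) [⋀^Fin n]→ₗ[ℝ] ℝ :=
  Matrix.detRowAlternating.compLinearMap (LinearMap.funLeft ℝ ℝ qIdx)

theorem qvol_eq {n : ℕ} (x : Vec (2 * n + 1)) (v : Fin n → Vec (2 * n + 1)) :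
    qvol x v = qvolAlt n v := rfl

theorem qvolAlt_eq_zero {n : ℕ} {v : Fin n → Vec (2 * n + 1)} (i : Fin n)
    (h : ∀ μ, v i (qIdx μ) = 0) : qvolAlt n v = 0 :=
  Matrix.det_eq_zero_of_row_eq_zero i h

theorem qvolAlt_chi {n : ℕ} {v : Fin n → Vec (2 * n + 1)} (i : Fin n)
    (h : v i = chi) : qvolAlt n v = 0 :=
  qvolAlt_eq_zero i fun μ => by simp [h, chi, basisVec]

theorem qvolAlt_pIdx {n : ℕ} {v : Fin n → Vec (2 * n + 1)} (i : Fin n) (ν : Fin n)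
    (h : v i = basisVec (pIdx ν)) : qvolAlt n v = 0 :=
  qvolAlt_eq_zero i fun μ => by simp [h, basisVec]

theorem botOp_apply {n k : ℕ} (ω : Form (2 * n + 1) (k + 2)) (x : Vec (2 * n + 1))
    (v : Fin k → Vec (2 * n + 1)) :
    botOp ω x v = ∑ μ, ω x (Fin.cons (basisVec (qIdx μ)) (Fin.cons (basisVec (pIdx μ)) v)) := by
  simp only [botOp, Finset.sum_apply]
  rfl

theorem removeNth_succ_cons {α : Type*} {k : ℕ} (a : α) (w : Fin (k + 1) → α) (i : Fin (k + 1)) :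
    i.succ.removeNth (Fin.cons a w : Fin (k + 2) → α) = Fin.cons a (i.removeNth w) := by
  funext l
  refine Fin.cases ?_ (fun l => ?_) l <;> simp [Fin.removeNth]

theorem botOp_dproj_lagrangian {m : ℕ} (L : Vec (2 * (m + 1) + 1) → ℝ) (hL : Differentiable ℝ L) :
    botOp (dproj (fsmul L (qvol (n := m + 1)))) = fun y (w : Fin m → Vec (2 * (m + 1) + 1)) =>
      ∑ μ, fderiv ℝ L y (basisVec (pIdx μ)) *
        (-(qvolAlt (m + 1)).curryLeft (basisVec (qIdx μ))) w := by
  funext y w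
  rw [botOp_apply (k := m)]
  refine Finset.sum_congr rfl fun μ _ => ?_
  have h := dproj_sum (fun _ : Unit => L) (fun _ => qvolAlt (m + 1)) (fun _ => hL)
    (fun _ v i h => qvolAlt_chi i h) y
    (Fin.cons (basisVec (qIdx μ)) (Fin.cons (basisVec (pIdx μ)) w))
  simp only [Finset.univ_unique, Finset.sum_singleton] at h
  refine h.trans ?_
  rw [Fin.sum_univ_succ, Fin.sum_univ_succ]
  have h0 : qvolAlt (m + 1) (Fin.removeNth 0 (Fin.cons (basisVec (qIdx μ))
      (Fin.cons (basisVec (pIdx μ)) w) : Fin (m + 2) → Vec (2 * (m + 1) + 1))) = 0 :=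
    qvolAlt_pIdx 0 μ (by simp [Fin.removeNth])
  have h2 : ∀ i : Fin m, qvolAlt (m + 1) (Fin.removeNth i.succ.succ (Fin.cons (basisVec (qIdx μ))
      (Fin.cons (basisVec (pIdx μ)) w) : Fin (m + 2) → Vec (2 * (m + 1) + 1))) = 0 := by
    intro i
    cases m with
    | zero => exact i.elim0
    | succ m =>
      refine qvolAlt_pIdx 1 μ ?_
      rw [removeNth_succ_cons, removeNth_succ_cons]
      rfl
  rw [h0, Finset.sum_eq_zero fun i _ => by rw [h2]; simp]
  rw [removeNth_succ_cons]
  simp [AlternatingMap.curryLeft_apply_apply, Matrix.vecCons]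

theorem euler_apply {m : ℕ} (L : Vec (2 * (m + 1) + 1) → ℝ) (hL : ContDiff ℝ (⊤ : ℕ∞) L)
    (x : Vec (2 * (m + 1) + 1)) (v : Fin (m + 1) → Vec (2 * (m + 1) + 1)) :
    euler (fsmul L (qvol (n := m + 1))) x v = fderiv ℝ L x chi * qvolAlt (m + 1) v -
      ∑ i : Fin (m + 1), (-1 : ℝ) ^ (i : ℕ) *
        ∑ μ, horizDiff (fun y => fderiv ℝ L y (basisVec (pIdx μ))) x (v i) *
          qvolAlt (m + 1) (Fin.cons (basisVec (qIdx μ)) (i.removeNth v)) := by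
  have hLd : Differentiable ℝ L := hL.differentiable (by simp)
  have h1 : Differentiable ℝ (fderiv ℝ L) :=
    (hL.fderiv_right (m := 1) (by norm_cast)).differentiable (by simp)
  have h := dproj_sum (fun μ y => fderiv ℝ L y (basisVec (pIdx μ)))
    (fun μ => -(qvolAlt (m + 1)).curryLeft (basisVec (qIdx μ)))
    (fun μ => h1.clm_apply (differentiable_const _))
    (fun μ w i h => by
      simp only [AlternatingMap.neg_apply, AlternatingMap.curryLeft_apply_apply, neg_eq_zero]
      exact qvolAlt_chi i.succ (by simpa using h)) x v
  rw [← botOp_dproj_lagrangian L hLd] at h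
  have h' : euler (fsmul L (qvol (n := m + 1))) x v =
    dproj (botOp (dproj (fsmul L (qvol (n := m + 1))))) x v +
      lieChi (fsmul L (qvol (n := m + 1))) x v := rfl
  rw [h']
  erw [h]
  have h3 : lieChi (fsmul L (qvol (n := m + 1))) x v =
      fderiv ℝ L x chi * qvolAlt (m + 1) v := by
    simp only [lieChi, fsmul, qvol_eq]
    rw [fderiv_mul_const hLd.differentiableAt]
    simp [mul_comm]
  rw [h3, add_comm, sub_eq_add_neg, ← Finset.sum_neg_distrib]
  congr 1
  refine Finset.sum_congr rfl fun i _ => ?_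
  simp [AlternatingMap.curryLeft_apply_apply, Matrix.vecCons]

/-- `E(Lβ)` at a point, as an alternating map. -/
def eulerAlt {m : ℕ} (L : Vec (2 * (m + 1) + 1) → ℝ) (x : Vec (2 * (m + 1) + 1)) :
    Vec (2 * (m + 1) + 1) [⋀^Fin (m + 1)]→ₗ[ℝ] ℝ :=
  fderiv ℝ L x chi • qvolAlt (m + 1) - AlternatingMap.alternatizeUncurryFin
    (∑ μ, (horizDiff (fun y => fderiv ℝ L y (basisVec (pIdx μ))) x).smulRight
      ((qvolAlt (m + 1)).curryLeft (basisVec (qIdx μ))))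

theorem euler_eq_eulerAlt {m : ℕ} (L : Vec (2 * (m + 1) + 1) → ℝ) (hL : ContDiff ℝ (⊤ : ℕ∞) L)
    (x : Vec (2 * (m + 1) + 1)) (v : Fin (m + 1) → Vec (2 * (m + 1) + 1)) :
    euler (fsmul L (qvol (n := m + 1))) x v = eulerAlt L x v := by
  rw [euler_apply L hL, eulerAlt, AlternatingMap.sub_apply,
    AlternatingMap.alternatizeUncurryFin_apply]
  simp [LinearMap.sum_apply, alternatingMap_sum_apply, AlternatingMap.curryLeft_apply_apply,
    Matrix.vecCons]

theorem eulerAlt_chi {m : ℕ} (L : Vec (2 * (m + 1) + 1) → ℝ) (hL : ContDiff ℝ (⊤ : ℕ∞) L)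
    (x : Vec (2 * (m + 1) + 1)) (w : Fin m → Vec (2 * (m + 1) + 1)) :
    eulerAlt L x (Fin.cons chi w) = 0 := by
  rw [← euler_eq_eulerAlt L hL, euler_apply L hL, qvolAlt_chi 0 (by simp), mul_zero, zero_sub,
    neg_eq_zero]
  refine Finset.sum_eq_zero fun i _ => ?_
  rw [Finset.sum_eq_zero, mul_zero]
  intro μ _
  refine Fin.cases ?_ (fun i => ?_) i
  · simp
  · rw [qvolAlt_chi 1, mul_zero]
    cases m with
    | zero => exact i.elim0
    | succ m => rw [removeNth_succ_cons]; rfl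

theorem eulerAlt_contraction {m : ℕ} (L : Vec (2 * (m + 2) + 1) → ℝ) (hL : ContDiff ℝ (⊤ : ℕ∞) L)
    (x : Vec (2 * (m + 2) + 1)) (w : Fin m → Vec (2 * (m + 2) + 1)) :
    ∑ ν, eulerAlt (m := m + 1) L x
      (Fin.cons (basisVec (qIdx ν)) (Fin.cons (basisVec (pIdx ν)) w)) = 0 := by
  set D : Fin (m + 2) → Fin (m + 2) → ℝ := fun μ ν =>
    fderiv ℝ (fun y => fderiv ℝ L y (basisVec (pIdx μ))) x (basisVec (pIdx ν)) with hD
  have hsymm : ∀ μ ν, D μ ν = D ν μ := by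
    have h1 : Differentiable ℝ (fderiv ℝ L) :=
      (hL.fderiv_right (m := 1) (by norm_cast)).differentiable (by simp)
    have h2 : IsSymmSndFDerivAt ℝ L x :=
      hL.contDiffAt.isSymmSndFDerivAt (by simp; norm_cast)
    have h3 : ∀ u w, fderiv ℝ (fun y => fderiv ℝ L y u) x w = fderiv ℝ (fderiv ℝ L) x w u := by
      intro u w
      rw [fderiv_clm_apply h1.differentiableAt (differentiableAt_const _)]
      simp
    intro μ ν
    simp only [hD, h3]
    exact h2.eq _ _
  set b : Fin (m + 2) → Fin (m + 2) → ℝ := fun μ ν =>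
    qvolAlt (m + 2) (Fin.cons (basisVec (qIdx μ)) (Fin.cons (basisVec (qIdx ν)) w)) with hb
  have hanti : ∀ μ ν, b μ ν = - b ν μ := by
    intro μ ν
    have := (qvolAlt (m + 2)).map_swap
      (Fin.cons (basisVec (qIdx ν)) (Fin.cons (basisVec (qIdx μ)) w)) (i := 0) (j := 1)
      (by simp)
    rw [hb]
    simp only
    rw [← this]
    congr 1
    funext l
    refine Fin.cases ?_ (fun l => Fin.cases ?_ (fun l => ?_) l) l
    · simp
    · rfl
    · have h1 : l.succ.succ ≠ 0 := Fin.succ_ne_zero _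
      have h2 : l.succ.succ ≠ 1 := by simp [Fin.ext_iff]
      simp [Equiv.swap_apply_of_ne_of_ne h1 h2]
  have hterm : ∀ ν, eulerAlt (m := m + 1) L x
      (Fin.cons (basisVec (qIdx ν)) (Fin.cons (basisVec (pIdx ν)) w)) =
        ∑ μ, D μ ν * b μ ν := by
    intro ν
    rw [← euler_eq_eulerAlt L hL, euler_apply L hL, qvolAlt_pIdx 1 ν rfl, mul_zero, zero_sub]
    have h0 : ∀ μ, qvolAlt (m + 2) (Fin.cons (basisVec (qIdx μ)) (Fin.removeNth 0
        (Fin.cons (basisVec (qIdx ν)) (Fin.cons (basisVec (pIdx ν)) w) :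
          Fin (m + 2) → Vec (2 * (m + 2) + 1)))) = 0 :=
      fun μ => qvolAlt_pIdx 1 ν rfl
    have h2 : ∀ (i : Fin m) (μ), qvolAlt (m + 2) (Fin.cons (basisVec (qIdx μ))
        (Fin.removeNth i.succ.succ
        (Fin.cons (basisVec (qIdx ν)) (Fin.cons (basisVec (pIdx ν)) w) :
          Fin (m + 2) → Vec (2 * (m + 2) + 1)))) = 0 := by
      intro i μ
      cases m with
      | zero => exact i.elim0
      | succ m =>
        refine qvolAlt_pIdx 2 ν ?_
        rw [removeNth_succ_cons, removeNth_succ_cons]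
        rfl
    rw [Fin.sum_univ_succ (n := m + 1), Finset.sum_eq_zero fun μ _ => by rw [h0, mul_zero],
      mul_zero, zero_add, Fin.sum_univ_succ (n := m), Finset.sum_eq_zero (s := Finset.univ)
      (f := fun i : Fin m => _) fun i _ => by
      rw [Finset.sum_eq_zero fun μ _ => by rw [h2, mul_zero], mul_zero], removeNth_succ_cons]
    simp [hD, hb]
  rw [Finset.sum_congr rfl fun ν _ => hterm ν]
  have h1 : ∑ ν, ∑ μ, D μ ν * b μ ν = - ∑ ν, ∑ μ, D μ ν * b μ ν := by
    conv_lhs => rw [Finset.sum_comm]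
    rw [← Finset.sum_neg_distrib]
    refine Finset.sum_congr rfl fun μ _ => ?_
    rw [← Finset.sum_neg_distrib]
    refine Finset.sum_congr rfl fun ν _ => ?_
    rw [hsymm μ ν, hanti μ ν]
    ring
  linarith

/-- The tangent vector with `q`-components `a` and `p`-components `b`. -/
def ofParts {n : ℕ} (a b : Vec n) : Vec (2 * n + 1) :=
  ∑ μ, a μ • basisVec (qIdx μ) + ∑ μ, b μ • basisVec (pIdx μ)

theorem ofParts_add {n : ℕ} (a b a' b' : Vec n) :
    ofParts (a + a') (b + b') = ofParts a b + ofParts a' b' := by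
  simp only [ofParts, Pi.add_apply, add_smul, Finset.sum_add_distrib]
  abel

theorem ofParts_smul {n : ℕ} (t : ℝ) (a b : Vec n) :
    ofParts (t • a) (t • b) = t • ofParts a b := by
  simp only [ofParts, Pi.smul_apply, smul_eq_mul, mul_smul, smul_add, Finset.smul_sum]

theorem ofParts_sum {n : ℕ} {κ : Type*} (s : Finset κ) (a b : κ → Vec n) :
    ofParts (∑ i ∈ s, a i) (∑ i ∈ s, b i) = ∑ i ∈ s, ofParts (a i) (b i) := by
  classical
  induction s using Finset.induction_on with
  | empty => simp [ofParts]
  | insert i s hi ih => rw [Finset.sum_insert hi, Finset.sum_insert hi, Finset.sum_insert hi,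
      ofParts_add, ih]

theorem idx_cases {n : ℕ} (i : Fin (2 * n + 1)) :
    (∃ μ : Fin n, i = qIdx μ) ∨ i = uIdx ∨ ∃ μ : Fin n, i = pIdx μ := by
  rcases lt_trichotomy (i : ℕ) n with h | h | h
  · exact Or.inl ⟨⟨i, h⟩, rfl⟩
  · exact Or.inr (Or.inl (Fin.ext h))
  · refine Or.inr (Or.inr ⟨⟨i - (n + 1), by omega⟩, Fin.ext ?_⟩)
    simp only [pIdx]
    omega

theorem eq_ofParts_add_chi {n : ℕ} (v : Vec (2 * n + 1)) :
    v = ofParts (v ∘ qIdx) (v ∘ pIdx) + v uIdx • chi := by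
  funext i
  rcases idx_cases i with ⟨μ, rfl⟩ | rfl | ⟨μ, rfl⟩ <;>
  simp [ofParts, chi, basisVec, Pi.single_apply]

/-- The frame of the tangent space of a first prolongation, for Hessian `A` and gradient `s`. -/
def graphFrame {n : ℕ} (s : Vec n) (A : Matrix (Fin n) (Fin n) ℝ) (i : Fin n) :
    Vec (2 * n + 1) :=
  ofParts (Pi.single i 1) (A i) + s i • chi

/-- The symplectic form `Ω`, as a bilinear map. -/
def sympLin (n : ℕ) : Vec (2 * n + 1) →ₗ[ℝ] Vec (2 * n + 1) →ₗ[ℝ] ℝ :=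
  ∑ μ : Fin n, (LinearMap.smulRight (LinearMap.proj (qIdx μ) : Vec (2 * n + 1) →ₗ[ℝ] ℝ)
      (LinearMap.proj (pIdx μ) : Vec (2 * n + 1) →ₗ[ℝ] ℝ) -
    LinearMap.smulRight (LinearMap.proj (pIdx μ) : Vec (2 * n + 1) →ₗ[ℝ] ℝ)
      (LinearMap.proj (qIdx μ) : Vec (2 * n + 1) →ₗ[ℝ] ℝ))

theorem sympLin_apply {n : ℕ} (v w : Vec (2 * n + 1)) :
    sympLin n v w = ∑ μ, (v (qIdx μ) * w (pIdx μ) - v (pIdx μ) * w (qIdx μ)) := by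
  simp [sympLin, LinearMap.sum_apply]

section Density

variable {n k : ℕ}

theorem alternatingMap_eq_ofParts {θ : Vec (2 * n + 1) [⋀^Fin k]→ₗ[ℝ] ℝ}
    (hθ : ∀ v i, v i = chi → θ v = 0) (v : Fin k → Vec (2 * n + 1)) :
    θ v = θ fun i => ofParts (v i ∘ qIdx) (v i ∘ pIdx) := by
  set π : Vec (2 * n + 1) →ₗ[ℝ] Vec (2 * n + 1) :=
    LinearMap.id - (LinearMap.proj uIdx).smulRight chi with hπ
  have h : θ.compLinearMap π = θ := by
    refine Module.Basis.ext_alternating (Pi.basisFun ℝ (Fin (2 * n + 1))) fun c _ => ?_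
    simp only [AlternatingMap.compLinearMap_apply]
    by_cases hc : ∃ i, c i = uIdx
    · obtain ⟨i, hi⟩ := hc
      rw [hθ (fun i => Pi.basisFun ℝ _ (c i)) i (by simp [hi, chi, basisVec]),
        AlternatingMap.map_coord_zero _ i]
      simp [hπ, hi, chi, basisVec]
    · push Not at hc
      congr 1
      funext i
      simp [hπ, hc i]
  rw [← h, AlternatingMap.compLinearMap_apply, h]
  congr 1
  funext i
  rw [hπ]
  conv_lhs => rw [eq_ofParts_add_chi (v i)]
  simp [ofParts, chi, basisVec]

theorem alternatingMap_eq_zero_of_invertible {θ : Vec (2 * n + 1) [⋀^Fin n]→ₗ[ℝ] ℝ}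
    (hgr : ∀ A : Matrix (Fin n) (Fin n) ℝ, A.IsSymm →
      (θ fun i => ofParts (Pi.single i 1) (A i)) = 0)
    (a b : Matrix (Fin n) (Fin n) ℝ) (hab : (a * b.transpose).IsSymm) (ha : a.det ≠ 0) :
    (θ fun i => ofParts (a i) (b i)) = 0 := by
  have hu : IsUnit a.det := ha.isUnit
  set A := a⁻¹ * b with hA
  have hb : a * A = b := by rw [hA, ← mul_assoc, Matrix.mul_nonsing_inv _ hu, one_mul]
  have hs : A.IsSymm := by
    have h1 : a * A.transpose * a.transpose = a * A * a.transpose := by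
      have := hab.eq
      rw [← hb, Matrix.transpose_mul, Matrix.transpose_mul, Matrix.transpose_mul] at this
      simpa [mul_assoc] using this.symm
    have hut : IsUnit a.transpose.det := by rwa [Matrix.det_transpose]
    have h2 := congrArg (fun X => a⁻¹ * X * a.transpose⁻¹) h1
    simp only [mul_assoc, Matrix.mul_nonsing_inv _ hut, mul_one] at h2
    rw [Matrix.IsSymm]
    simpa [← mul_assoc, Matrix.nonsing_inv_mul _ hu] using h2
  set Y : (Fin n → ℝ) →ₗ[ℝ] Vec (2 * n + 1) :=
    Fintype.linearCombination ℝ fun i => ofParts (Pi.single i 1) (A i) with hY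
  have h0 : θ.compLinearMap Y = 0 := by
    rw [(θ.compLinearMap Y).eq_smul_basis_det (Pi.basisFun ℝ (Fin n))]
    have : θ.compLinearMap Y (Pi.basisFun ℝ (Fin n)) = 0 := by
      rw [← hgr A hs, AlternatingMap.compLinearMap_apply]
      congr 1
      funext i
      simp [hY, Fintype.linearCombination_apply, Pi.single_apply]
    rw [this, zero_smul]
  have h1 : (θ fun i => Y (a i)) = 0 := DFunLike.congr_fun h0 a
  convert h1 using 2
  funext i
  simp only [hY, Fintype.linearCombination_apply, ← ofParts_smul, ← ofParts_sum]
  congr 1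
  · funext j
    simp [Finset.sum_apply, Pi.single_apply]
  · rw [← hb]
    funext j
    simp [Finset.sum_apply, Matrix.mul_apply]

theorem multilinearMap_apply_eq_sum {m k : ℕ}
    (f : MultilinearMap ℝ (fun _ : Fin k => Vec m) ℝ) (v : Fin k → Vec m) :
    f v = ∑ c : Fin k → Fin m, (∏ i, v i (c i)) * f fun i => basisVec (c i) := by
  have h : v = fun i => ∑ j, v i j • basisVec j := by
    funext i
    exact pi_eq_sum_univ' (v i)
  conv_lhs => rw [h]
  rw [MultilinearMap.map_sum]
  simp [MultilinearMap.map_smul_univ]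

theorem multilinearMap_continuous {m k : ℕ}
    (f : MultilinearMap ℝ (fun _ : Fin k => Vec m) ℝ) : Continuous f := by
  have h : ⇑f = fun v => ∑ c : Fin k → Fin m, (∏ i, v i (c i)) * f fun i => basisVec (c i) :=
    funext (multilinearMap_apply_eq_sum f)
  rw [h]
  fun_prop

theorem exists_vecMul_eq_zero_of_complex_det_eq_zero (a b : Matrix (Fin n) (Fin n) ℝ)
    (hab : (a * b.transpose).IsSymm)
    (h : (a.map Complex.ofRealHom + Complex.I • b.map Complex.ofRealHom).det = 0) :
    ∃ c : Fin n → ℝ, c ≠ 0 ∧ Matrix.vecMul c a = 0 ∧ Matrix.vecMul c b = 0 := by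
  have hab' : b * a.transpose = a * b.transpose := by
    rw [← hab.eq, Matrix.transpose_mul, Matrix.transpose_transpose]
  have h1 : (a * a.transpose + b * b.transpose).det = 0 := by
    have h2 : (a * a.transpose + b * b.transpose).map Complex.ofRealHom =
        (a.map Complex.ofRealHom + Complex.I • b.map Complex.ofRealHom) *
        (a.transpose.map Complex.ofRealHom - Complex.I • b.transpose.map Complex.ofRealHom) := by
      have h3 := congrArg (fun X => X.map Complex.ofRealHom) hab'
      simp only [Matrix.map_mul] at h3
      rw [add_mul, mul_sub, mul_sub, Matrix.map_add _ (map_add _), Matrix.map_mul, Matrix.map_mul]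
      simp only [Matrix.smul_mul, Matrix.mul_smul, smul_smul, Complex.I_mul_I, h3, neg_smul,
        one_smul]
      abel
    have h4 := congrArg Matrix.det h2
    rw [Matrix.det_mul, h, zero_mul, ← RingHom.mapMatrix_apply, ← RingHom.map_det] at h4
    simpa using h4
  obtain ⟨c, hc, hc0⟩ := Matrix.exists_vecMul_eq_zero_iff.2 h1
  have h2 : Matrix.vecMul c a ⬝ᵥ Matrix.vecMul c a + Matrix.vecMul c b ⬝ᵥ Matrix.vecMul c b = 0 := by
    have := congrArg (· ⬝ᵥ c) hc0
    simp only [Matrix.vecMul_add, ← Matrix.vecMul_vecMul, add_dotProduct, zero_dotProduct,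
      Matrix.vecMul_transpose] at this
    rw [← this]
    simp only [Matrix.dotProduct_mulVec, dotProduct_comm (Matrix.mulVec _ _) c]
  have h3 : ∀ w : Fin n → ℝ, 0 ≤ w ⬝ᵥ w := fun w =>
    Finset.sum_nonneg fun i _ => mul_self_nonneg _
  refine ⟨c, hc, ?_, ?_⟩
  · exact dotProduct_self_eq_zero.1 (by linarith [h3 (Matrix.vecMul c a), h3 (Matrix.vecMul c b)])
  · exact dotProduct_self_eq_zero.1 (by linarith [h3 (Matrix.vecMul c a), h3 (Matrix.vecMul c b)])

theorem alternatingMap_eq_zero_of_isSymm {θ : Vec (2 * n + 1) [⋀^Fin n]→ₗ[ℝ] ℝ}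
    (hgr : ∀ A : Matrix (Fin n) (Fin n) ℝ, A.IsSymm →
      (θ fun i => ofParts (Pi.single i 1) (A i)) = 0)
    (a b : Matrix (Fin n) (Fin n) ℝ) (hab : (a * b.transpose).IsSymm) :
    (θ fun i => ofParts (a i) (b i)) = 0 := by
  by_cases hdet : (a.map Complex.ofRealHom + Complex.I • b.map Complex.ofRealHom).det = 0
  · obtain ⟨c, hc, hca, hcb⟩ := exists_vecMul_eq_zero_of_complex_det_eq_zero a b hab hdet
    refine AlternatingMap.map_linearDependent _ _ fun hli => hc ?_
    rw [Fintype.linearIndependent_iff] at hli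
    refine funext (hli c ?_)
    simp only [← ofParts_smul, ← ofParts_sum]
    have h1 : ∀ d : Matrix (Fin n) (Fin n) ℝ, ∑ i, c i • d i = Matrix.vecMul c d := fun d => by
      funext j
      simp [Matrix.vecMul, dotProduct, Finset.sum_apply]
    rw [h1, h1, hca, hcb]
    simp [ofParts]
  · set P : Polynomial ℝ :=
      (a.map Polynomial.C + (Polynomial.X : Polynomial ℝ) • b.map Polynomial.C).det with hP
    have hev : ∀ t, P.eval t = (a + t • b).det := by
      intro t
      rw [hP, ← Polynomial.coe_evalRingHom, RingHom.map_det]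
      congr 1
      ext i j
      simp
      ring
    have hP0 : P ≠ 0 := by
      intro h0
      apply hdet
      have : P.eval₂ Complex.ofRealHom Complex.I = 0 := by rw [h0]; simp
      rw [← this, hP, ← Polynomial.coe_eval₂RingHom, RingHom.map_det]
      congr 1
      ext i j
      simp
      ring
    have hdense : Dense {t : ℝ | P.eval t = 0}ᶜ := by
      refine Set.Countable.dense_compl ℝ (Set.Finite.countable ?_)
      exact (Polynomial.finite_setOfPred_isRoot hP0)
    have hcont : Continuous fun t : ℝ => θ fun i => ofParts ((a + t • b) i) (b i) := by
      have h1 : Continuous fun v : Fin n → Vec (2 * n + 1) => θ v :=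
        multilinearMap_continuous θ.toMultilinearMap
      refine h1.comp (continuous_pi fun i => ?_)
      simp only [ofParts]
      fun_prop
    have h := hcont.ext_on hdense (continuous_const (y := (0 : ℝ))) fun t ht =>
      alternatingMap_eq_zero_of_invertible hgr (a + t • b) b ?_ ?_
    · simpa using congrFun h 0
    · rw [add_mul, Matrix.smul_mul]
      exact hab.add ((Matrix.isSymm_mul_transpose_self b).smul t)
    · rw [← hev]
      exact ht

/-- An alternating form killed by `χ` and vanishing on the tangent spaces of all first
prolongations through a point vanishes on all isotropic tuples. -/
theorem alternatingMap_eq_zero_of_graphFrame {θ : Vec (2 * n + 1) [⋀^Fin n]→ₗ[ℝ] ℝ}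
    (hθ : ∀ v i, v i = chi → θ v = 0) (s : Vec n)
    (hgr : ∀ A : Matrix (Fin n) (Fin n) ℝ, A.IsSymm → θ (graphFrame s A) = 0)
    (v : Fin n → Vec (2 * n + 1)) (hv : ∀ i j, sympLin n (v i) (v j) = 0) : θ v = 0 := by
  rw [alternatingMap_eq_ofParts hθ]
  refine alternatingMap_eq_zero_of_isSymm (fun A hA => ?_) (Matrix.of fun i j => v i (qIdx j))
    (Matrix.of fun i j => v i (pIdx j)) ?_
  · rw [← hgr A hA, alternatingMap_eq_ofParts hθ (graphFrame s A)]
    congr 1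
    funext i
    congr 1 <;> funext μ <;> simp [graphFrame, ofParts, chi, basisVec, Pi.single_apply]
  · ext i j
    have := hv i j
    rw [sympLin_apply, Finset.sum_sub_distrib, sub_eq_zero] at this
    simp only [Matrix.transpose_apply, Matrix.mul_apply, Matrix.of_apply]
    rw [this]
    exact Finset.sum_congr rfl fun _ _ => mul_comm _ _

end Density

section Jets

variable {n : ℕ}

theorem jet_qIdx (φ : Vec n → ℝ) (x : Vec n) (μ : Fin n) : jet φ x (qIdx μ) = x μ := by
  simp [jet, qIdx]

theorem jet_uIdx (φ : Vec n → ℝ) (x : Vec n) : jet φ x uIdx = φ x := by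
  simp [jet, uIdx]

theorem jet_pIdx (φ : Vec n → ℝ) (x : Vec n) (μ : Fin n) :
    jet φ x (pIdx μ) = fderiv ℝ φ x (basisVec μ) := by
  have h1 : ¬ n + 1 + (μ : ℕ) < n := by omega
  have h2 : n + 1 + (μ : ℕ) ≠ n := by omega
  simp [jet, pIdx, h1, h2]

/-- The quadratic polynomial with prescribed 2-jet at `x₀`. -/
def quadPoly (u : ℝ) (p x₀ : Vec n) (A : Matrix (Fin n) (Fin n) ℝ) (x : Vec n) : ℝ :=
  u + ∑ i, p i * (x i - x₀ i) + 2⁻¹ * ∑ i, ∑ j, A i j * ((x i - x₀ i) * (x j - x₀ j))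

theorem contDiff_quadPoly (u : ℝ) (p x₀ : Vec n) (A : Matrix (Fin n) (Fin n) ℝ) :
    ContDiff ℝ (⊤ : ℕ∞) (quadPoly u p x₀ A) := by
  unfold quadPoly
  fun_prop

theorem fderiv_quadPoly (u : ℝ) (p x₀ : Vec n) {A : Matrix (Fin n) (Fin n) ℝ} (hA : A.IsSymm)
    (x : Vec n) (μ : Fin n) :
    fderiv ℝ (quadPoly u p x₀ A) x (basisVec μ) = p μ + ∑ j, A μ j * (x j - x₀ j) := by
  have hc : ∀ i, HasFDerivAt (fun y : Vec n => y i - x₀ i)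
      (ContinuousLinearMap.proj (R := ℝ) (φ := fun _ : Fin n => ℝ) i) x := fun i =>
    (ContinuousLinearMap.proj (R := ℝ) (φ := fun _ : Fin n => ℝ) i).hasFDerivAt.sub_const _
  have h : HasFDerivAt (quadPoly u p x₀ A) _ x :=
    ((HasFDerivAt.fun_sum fun i (_ : i ∈ Finset.univ) => (hc i).const_mul (p i)).const_add u).add
      ((HasFDerivAt.fun_sum fun i (_ : i ∈ Finset.univ) =>
        HasFDerivAt.fun_sum fun j (_ : j ∈ Finset.univ) =>
          ((hc i).mul (hc j)).const_mul (A i j)).const_mul 2⁻¹)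
  rw [h.fderiv]
  have h1 : ∑ i, ∑ j, A i j * ((x i - x₀ i) * (Pi.single μ 1 : Vec n) j) =
      ∑ j, A μ j * (x j - x₀ j) := by
    refine Finset.sum_congr rfl fun i _ => ?_
    rw [← hA.apply μ i]
    simp [Pi.single_apply]
  have h2 : ∑ i, ∑ j, A i j * ((x j - x₀ j) * (Pi.single μ 1 : Vec n) i) =
      ∑ j, A μ j * (x j - x₀ j) := by
    rw [Finset.sum_comm]
    refine Finset.sum_congr rfl fun i _ => ?_
    simp [Pi.single_apply]
  simp only [add_apply, smul_apply, _root_.sum_apply, ContinuousLinearMap.proj_apply, basisVec,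
    smul_eq_mul, mul_add, Finset.sum_add_distrib, h1, h2]
  simp [Pi.single_apply]
  ring

theorem fderiv_jet_quadPoly (u : ℝ) (p x₀ : Vec n) {A : Matrix (Fin n) (Fin n) ℝ}
    (hA : A.IsSymm) (μ : Fin n) :
    fderiv ℝ (jet (quadPoly u p x₀ A)) x₀ (basisVec μ) = graphFrame p A μ := by
  have hp : ∀ (ν : Fin n) (y : Vec n), jet (quadPoly u p x₀ A) y (pIdx ν) =
      p ν + ∑ j, A ν j * (y j - x₀ j) := fun ν y => by
    rw [jet_pIdx, fderiv_quadPoly u p x₀ hA]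
  have hd : ∀ i, DifferentiableAt ℝ (fun y => jet (quadPoly u p x₀ A) y i) x₀ := by
    intro i
    rcases idx_cases i with ⟨ν, rfl⟩ | rfl | ⟨ν, rfl⟩
    · simp only [jet_qIdx]; fun_prop
    · simp only [jet_uIdx]
      exact ((contDiff_quadPoly u p x₀ A).differentiable (by simp)).differentiableAt
    · simp only [hp]; fun_prop
  funext i
  rw [fderiv_pi hd, ContinuousLinearMap.pi_apply]
  rcases idx_cases i with ⟨ν, rfl⟩ | rfl | ⟨ν, rfl⟩
  · simp only [jet_qIdx]
    have h : HasFDerivAt (fun y : Vec n => y ν) _ x₀ :=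
      (ContinuousLinearMap.proj (R := ℝ) (φ := fun _ : Fin n => ℝ) ν).hasFDerivAt
    rw [h.fderiv]
    simp [graphFrame, ofParts, chi, basisVec, Pi.single_apply]
  · simp only [jet_uIdx]
    rw [fderiv_quadPoly u p x₀ hA]
    simp [graphFrame, ofParts, chi, basisVec]
  · simp only [hp]
    have h : HasFDerivAt (fun y : Vec n => p ν + ∑ j, A ν j * (y j - x₀ j)) _ x₀ :=
      (HasFDerivAt.fun_sum fun j (_ : j ∈ Finset.univ) =>
        (((ContinuousLinearMap.proj (R := ℝ) (φ := fun _ : Fin n => ℝ) j).hasFDerivAt.sub_const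
          (x₀ j)).const_mul (A ν j))).const_add (p ν)
    rw [h.fderiv]
    simp [← hA.apply μ ν, graphFrame, ofParts, chi, basisVec, Pi.single_apply, _root_.sum_apply]

theorem jet_quadPoly_self (z : Vec (2 * n + 1)) {A : Matrix (Fin n) (Fin n) ℝ} (hA : A.IsSymm) :
    jet (quadPoly (z uIdx) (z ∘ pIdx) (z ∘ qIdx) A) (z ∘ qIdx) = z := by
  funext i
  rcases idx_cases i with ⟨ν, rfl⟩ | rfl | ⟨ν, rfl⟩
  · rw [jet_qIdx]; rfl
  · simp [jet_uIdx, quadPoly]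
  · simp [jet_pIdx, fderiv_quadPoly _ _ _ hA]

/-- A form in the kernel of all pullbacks by first prolongations vanishes on isotropic tuples. -/
theorem eq_zero_of_pullback_jet_eq_zero {τ : Form (2 * n + 1) n}
    (hτ : ∀ φ : Vec n → ℝ, ContDiff ℝ (⊤ : ℕ∞) φ → pullback (jet φ) τ = 0)
    {z : Vec (2 * n + 1)} {θ : Vec (2 * n + 1) [⋀^Fin n]→ₗ[ℝ] ℝ} (hθτ : ∀ v, τ z v = θ v)
    (hθ : ∀ v i, v i = chi → θ v = 0) (v : Fin n → Vec (2 * n + 1))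
    (hv : ∀ i j, sympLin n (v i) (v j) = 0) : θ v = 0 := by
  refine alternatingMap_eq_zero_of_graphFrame hθ (z ∘ pIdx) (fun A hA => ?_) v hv
  have h := congrFun (congrFun (hτ _ (contDiff_quadPoly (z uIdx) (z ∘ pIdx) (z ∘ qIdx) A))
    (z ∘ qIdx)) fun i => basisVec i
  simp only [pullback, fderiv_jet_quadPoly _ _ _ hA, jet_quadPoly_self z hA] at h
  rw [← hθτ]
  exact h

end Jets

theorem symp_eq {n : ℕ} (z : Vec (2 * n + 1)) (w : Fin 2 → Vec (2 * n + 1)) :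
    symp z w = sympLin n (w 0) (w 1) := by
  rw [sympLin_apply, symp, Finset.sum_apply, Finset.sum_apply]
  refine Finset.sum_congr rfl fun μ _ => ?_
  have h := wedge_one_apply (j := 1) (ω := dx (qIdx μ)) (η := dx (pIdx μ)) (x := z)
    (LinearMap.proj (qIdx μ)) (AlternatingMap.ofSubsingleton ℝ _ ℝ 0 (LinearMap.proj (pIdx μ)))
    (fun _ => rfl) (fun _ => rfl) w
  refine (show _ = _ from h).trans ?_
  simp [Fin.sum_univ_two, Fin.removeNth]
  ring

section Span

variable {W : Type*} [AddCommGroup W] [Module ℝ W]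

/-- An alternating map vanishing on tuples from a spanning set is zero. -/
theorem alternatingMap_eq_zero_of_span_eq_top {k : ℕ} {S : Set W} (hS : Submodule.span ℝ S = ⊤)
    (η : W [⋀^Fin k]→ₗ[ℝ] ℝ) (h : ∀ v, (∀ i, v i ∈ S) → η v = 0) (v : Fin k → W) : η v = 0 := by
  have key : ∀ (s : Finset (Fin k)) (v : Fin k → W), (∀ i ∉ s, v i ∈ S) → η v = 0 := by
    intro s
    induction s using Finset.induction_on with
    | empty => exact fun v hv => h v fun i => hv i (Finset.notMem_empty i)
    | insert a s _ ih =>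
      intro v hv
      have hy : ∀ y ∈ Submodule.span ℝ S, η (Function.update v a y) = 0 := by
        intro y hy
        induction hy using Submodule.span_induction with
        | mem y hy =>
          refine ih _ fun i hi => ?_
          by_cases hia : i = a
          · subst hia; simpa using hy
          · rw [Function.update_of_ne hia]
            exact hv i (by simp [hia, hi])
        | zero => exact η.map_update_zero v a
        | add y y' _ _ h1 h2 => rw [η.map_update_add, h1, h2, add_zero]
        | smul t y _ h1 => rw [η.map_update_smul, h1, smul_zero]
      simpa using hy (v a) (hS ▸ Submodule.mem_top)
  exact key Finset.univ v fun i hi => absurd (Finset.mem_univ i) hi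

/-- The multilinear map with prescribed values on tuples of standard basis vectors. -/
def multilinearOfBasis {J : Type*} [Fintype J] {k : ℕ} (F : (Fin k → J) → ℝ) :
    MultilinearMap ℝ (fun _ : Fin k => J → ℝ) ℝ :=
  letI := Classical.decEq J
  ∑ c : Fin k → J, F c • (MultilinearMap.mkPiAlgebra ℝ (Fin k) ℝ).compLinearMap
    fun i => LinearMap.proj (c i)

theorem multilinearOfBasis_single {J : Type*} [Fintype J] [DecidableEq J] {k : ℕ}
    (F : (Fin k → J) → ℝ) (c : Fin k → J) :
    (multilinearOfBasis F fun i => Pi.single (c i) 1) = F c := by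
  classical
  rw [multilinearOfBasis, _root_.sum_apply, Finset.sum_eq_single c]
  · simp
  · intro b _ hb
    obtain ⟨i, hi⟩ := Function.ne_iff.1 hb
    simp only [_root_.smul_apply, MultilinearMap.compLinearMap_apply,
      MultilinearMap.mkPiAlgebra_apply, LinearMap.proj_apply]
    rw [Finset.prod_eq_zero (Finset.mem_univ i) (by simp [hi]), smul_zero]
  · simp

/-- A bilinear form, as a multilinear map on pairs. -/
def bilinToMultilinear (B : W →ₗ[ℝ] W →ₗ[ℝ] ℝ) : MultilinearMap ℝ (fun _ : Fin 2 => W) ℝ :=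
  MultilinearMap.mk' (fun v => B (v 0) (v 1))
    (fun v i x y => by fin_cases i <;> simp) (fun v i t x => by fin_cases i <;> simp)

/-- The product of a multilinear map with a bilinear form in two further arguments. -/
def mulBilin {m : ℕ} (X : MultilinearMap ℝ (fun _ : Fin m => W) ℝ) (B : W →ₗ[ℝ] W →ₗ[ℝ] ℝ) :
    MultilinearMap ℝ (fun _ : Fin (m + 2) => W) ℝ :=
  ((LinearMap.mul' ℝ ℝ).compMultilinearMap (X.domCoprod (bilinToMultilinear B))).domDomCongr
    finSumFinEquiv

theorem mulBilin_apply {m : ℕ} (X : MultilinearMap ℝ (fun _ : Fin m => W) ℝ)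
    (B : W →ₗ[ℝ] W →ₗ[ℝ] ℝ) (v : Fin (m + 2) → W) :
    mulBilin X B v = X (fun i => v (Fin.castAdd 2 i)) *
      B (v (Fin.natAdd m 0)) (v (Fin.natAdd m 1)) := by
  simp [mulBilin, bilinToMultilinear, MultilinearMap.domCoprod]

end Span

section Decomposition

variable {n m : ℕ}

theorem sympLin_q_q (μ ν : Fin n) : sympLin n (basisVec (qIdx μ)) (basisVec (qIdx ν)) = 0 := by
  simp [sympLin_apply, basisVec]

theorem sympLin_p_p (μ ν : Fin n) : sympLin n (basisVec (pIdx μ)) (basisVec (pIdx ν)) = 0 := by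
  simp [sympLin_apply, basisVec]

theorem sympLin_q_p (μ ν : Fin n) :
    sympLin n (basisVec (qIdx μ)) (basisVec (pIdx ν)) = if μ = ν then 1 else 0 := by
  simp [sympLin_apply, basisVec, Pi.single_apply, eq_comm]

theorem sympLin_self (v : Vec (2 * n + 1)) : sympLin n v v = 0 := by
  rw [sympLin_apply]
  exact Finset.sum_eq_zero fun μ _ => by ring

theorem span_symplecticGens_eq_top {W : Type*} [AddCommGroup W] [Module ℝ W]
    (G : W →ₗ[ℝ] Vec (2 * n + 1)) (q p : Fin n → W)
    (hq : ∀ μ, G (q μ) = basisVec (qIdx μ)) (hp : ∀ μ, G (p μ) = basisVec (pIdx μ)) :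
    Submodule.span ℝ (symplecticGens ((sympLin n).compl₁₂ G G) Finset.univ q p) = ⊤ := by
  refine Submodule.eq_top_iff'.2 fun w => ?_
  set S := Submodule.span ℝ (symplecticGens ((sympLin n).compl₁₂ G G) Finset.univ q p)
  set r := w - (∑ μ, G w (qIdx μ) • q μ + ∑ μ, G w (pIdx μ) • p μ) with hr
  have hrS : r ∈ S := by
    refine Submodule.subset_span (Or.inl fun w' => ?_)
    have h : G r = G w uIdx • chi := by
      have h1 := eq_ofParts_add_chi (G w)
      simp only [hr, map_sub, map_add, map_sum, map_smul, hq, hp]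
      exact sub_eq_iff_eq_add.2 (h1.trans (add_comm _ _))
    rw [LinearMap.compl₁₂_apply, h, map_smul, LinearMap.smul_apply, sympLin_apply]
    simp [chi, basisVec]
  have hw : w = r + (∑ μ, G w (qIdx μ) • q μ + ∑ μ, G w (pIdx μ) • p μ) := by
    rw [hr, sub_add_cancel]
  rw [hw]
  refine S.add_mem hrS (S.add_mem (S.sum_mem fun μ _ => S.smul_mem _ ?_)
    (S.sum_mem fun μ _ => S.smul_mem _ ?_))
  · exact Submodule.subset_span (Or.inr ⟨μ, Finset.mem_univ μ, Or.inl rfl⟩)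
  · exact Submodule.subset_span (Or.inr ⟨μ, Finset.mem_univ μ, Or.inr rfl⟩)

theorem update_update_eq_cons_comp {α : Type*} (v : Fin (m + 2) → α) {i j : Fin (m + 2)}
    (hij : i ≠ j) : ∃ (σ : Equiv.Perm (Fin (m + 2))) (w : Fin m → α), ∀ a b,
      Function.update (Function.update v i a) j b ∘ σ =
        (Fin.cons a (Fin.cons b w : Fin (m + 1) → α) : Fin (m + 2) → α) := by
  set σ : Equiv.Perm (Fin (m + 2)) := Equiv.swap (Equiv.swap 0 i 1) j * Equiv.swap 0 i with hσ
  have h1 : σ 1 = j := by simp [hσ]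
  have h0 : σ 0 = i := by
    have h : i ≠ Equiv.swap 0 i 1 := fun h => by
      have := congrArg (Equiv.swap 0 i) h
      simp at this
    simp only [hσ, Equiv.Perm.mul_apply, Equiv.swap_apply_left]
    exact Equiv.swap_apply_of_ne_of_ne h hij
  refine ⟨σ, fun l => v (σ l.succ.succ), fun a b => ?_⟩
  funext l
  refine Fin.cases ?_ (fun l => Fin.cases ?_ (fun l => ?_) l) l
  · simp [h0, Function.update_of_ne hij]
  · have : σ (Fin.succ 0) = j := h1
    simp [h1]
  · have hi : σ l.succ.succ ≠ i := fun h => by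
      rw [← h0] at h
      exact Fin.succ_ne_zero _ (σ.injective h)
    have hj : σ l.succ.succ ≠ j := fun h => by
      rw [← h1] at h
      have := σ.injective h
      simp [Fin.ext_iff] at this
    simp [Function.update_of_ne hi, Function.update_of_ne hj]

/-- An alternating map on `J → ℝ` whose contraction vanishes on tuples of basis vectors has
vanishing contraction. -/
theorem contraction_eq_zero {J κ : Type*} [Fintype J] [DecidableEq J] [Fintype κ]
    (η : (J → ℝ) [⋀^Fin (m + 2)]→ₗ[ℝ] ℝ) (q p : κ → J)
    (h : ∀ c : Fin m → J, ∑ a, (η fun i => Pi.single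
      ((Fin.cons (q a) (Fin.cons (p a) c : Fin (m + 1) → J) : Fin (m + 2) → J) i) 1) = 0)
    (v : Fin (m + 2) → J → ℝ) (i j : Fin (m + 2)) (hij : i ≠ j) :
    ∑ a, η (Function.update (Function.update v i (Pi.single (q a) 1)) j (Pi.single (p a) 1)) =
      0 := by
  have h0 : ∑ a, (η.curryLeft (Pi.single (q a) 1)).curryLeft (Pi.single (p a) 1) = 0 := by
    refine Module.Basis.ext_alternating (Pi.basisFun ℝ J) fun c _ => ?_
    rw [alternatingMap_sum_apply, AlternatingMap.zero_apply, ← h c]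
    refine Finset.sum_congr rfl fun a _ => ?_
    rw [AlternatingMap.curryLeft_apply_apply, AlternatingMap.curryLeft_apply_apply]
    congr 1
    funext l
    refine Fin.cases ?_ (fun l => Fin.cases ?_ (fun l => ?_) l) l <;> simp
  obtain ⟨σ, w, hσ⟩ := update_update_eq_cons_comp v hij
  have h1 : ∀ a, η (Function.update (Function.update v i (Pi.single (q a) 1)) j
      (Pi.single (p a) 1)) = ((Equiv.Perm.sign σ : ℤ) : ℝ) *
        (η.curryLeft (Pi.single (q a) 1)).curryLeft (Pi.single (p a) 1) w := by
    intro a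
    have := η.map_perm (Function.update (Function.update v i (Pi.single (q a) 1)) j
      (Pi.single (p a) 1)) σ
    rw [hσ] at this
    rw [AlternatingMap.curryLeft_apply_apply, AlternatingMap.curryLeft_apply_apply,
      Matrix.vecCons, Matrix.vecCons, this, Units.smul_def, zsmul_eq_mul, ← mul_assoc,
      ← Int.cast_mul, ← Units.val_mul, Int.units_mul_self]
    simp
  have h2 := DFunLike.congr_fun h0 w
  rw [alternatingMap_sum_apply, AlternatingMap.zero_apply] at h2
  simp only [h1]
  rw [← Finset.mul_sum, h2, mul_zero]

/-- Uniqueness in the Hodge–Lepage decomposition: if `ε = ρ + θ - X ∧ Ω` with `ε` and `ρ`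
killed by contraction with the bivector dual to `Ω`, and `θ` vanishing on isotropic tuples,
then `ε = ρ`. Here `ε` and `X` need not be multilinear. -/
theorem eq_of_lepage (ε : (Fin (m + 2) → Vec (2 * (m + 2) + 1)) → ℝ)
    (X : (Fin m → Vec (2 * (m + 2) + 1)) → ℝ)
    (ρ θ : Vec (2 * (m + 2) + 1) [⋀^Fin (m + 2)]→ₗ[ℝ] ℝ) (t : ℝ)
    (hεX : ∀ v, ε v = ρ v + θ v - t * ∑ σ : Equiv.Perm (Fin (m + 2)),
      ((Equiv.Perm.sign σ : ℤ) : ℝ) * (X fun i => v (σ (Fin.castAdd 2 i))) *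
        sympLin (m + 2) (v (σ (Fin.natAdd m 0))) (v (σ (Fin.natAdd m 1))))
    (hε : ∀ w : Fin m → Vec (2 * (m + 2) + 1), ∑ μ, ε (Fin.cons (basisVec (qIdx μ))
      (Fin.cons (basisVec (pIdx μ)) w : Fin (m + 1) → Vec (2 * (m + 2) + 1))) = 0)
    (hρ : ∀ w : Fin m → Vec (2 * (m + 2) + 1), ∑ μ, ρ (Fin.cons (basisVec (qIdx μ))
      (Fin.cons (basisVec (pIdx μ)) w : Fin (m + 1) → Vec (2 * (m + 2) + 1))) = 0)
    (hθ : ∀ v, (∀ i j, sympLin (m + 2) (v i) (v j) = 0) → θ v = 0)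
    (v : Fin (m + 2) → Vec (2 * (m + 2) + 1)) : ε v = ρ v := by
  set J := Fin (m + 2) ⊕ Fin (m + 2) ⊕ Fin (m + 2)
  set g : J → Vec (2 * (m + 2) + 1) := Sum.elim (fun μ => basisVec (qIdx μ))
    (Sum.elim (fun μ => basisVec (pIdx μ)) v) with hg
  set G : (J → ℝ) →ₗ[ℝ] Vec (2 * (m + 2) + 1) := Fintype.linearCombination ℝ g with hG
  have hGe : ∀ j, G (Pi.single j 1) = g j := fun j => by
    simp [hG, Fintype.linearCombination_apply, Pi.single_apply]
  set B := (sympLin (m + 2)).compl₁₂ G G with hB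
  have hBa : ∀ w w', B w w' = sympLin (m + 2) (G w) (G w') := fun _ _ => rfl
  set M := mulBilin (multilinearOfBasis fun c : Fin m → J => X (g ∘ c)) B with hM
  set η : (J → ℝ) [⋀^Fin (m + 2)]→ₗ[ℝ] ℝ :=
    θ.compLinearMap G - t • MultilinearMap.alternatization M with hη
  have hηv : ∀ w, η w = (θ fun i => G (w i)) - t * ∑ σ : Equiv.Perm (Fin (m + 2)),
      ((Equiv.Perm.sign σ : ℤ) : ℝ) * M fun i => w (σ i) := by
    intro w
    simp [hη, MultilinearMap.alternatization_apply, Units.smul_def]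
  have hηe : ∀ c : Fin (m + 2) → J, (η fun i => Pi.single (c i) 1) =
      ε (fun i => g (c i)) - ρ fun i => g (c i) := by
    intro c
    rw [hεX, hηv]
    simp only [hM, mulBilin_apply, multilinearOfBasis_single, hBa, hGe, Function.comp_def,
      ← mul_assoc]
    ring
  have hgc : ∀ (a b : J) (c : Fin m → J),
      (fun i => g ((Fin.cons a (Fin.cons b c : Fin (m + 1) → J) : Fin (m + 2) → J) i)) =
      (Fin.cons (g a) (Fin.cons (g b) (g ∘ c) : Fin (m + 1) → Vec (2 * (m + 2) + 1)) :
        Fin (m + 2) → Vec (2 * (m + 2) + 1)) := by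
    intro a b c
    funext l
    refine Fin.cases ?_ (fun l => Fin.cases ?_ (fun l => ?_) l) l <;> simp
  set q : Fin (m + 2) → J → ℝ := fun μ => Pi.single (Sum.inl μ) 1
  set p : Fin (m + 2) → J → ℝ := fun μ => Pi.single (Sum.inr (Sum.inl μ)) 1
  have hq : ∀ μ, G (q μ) = basisVec (qIdx μ) := fun μ => hGe _
  have hp : ∀ μ, G (p μ) = basisVec (pIdx μ) := fun μ => hGe _
  have hfam : IsSymplecticFamily B Finset.univ q p :=
    { qq := by simp [hBa, hq, sympLin_q_q]
      pp := by simp [hBa, hp, sympLin_p_p]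
      qp := by simp [hBa, hq, hp, sympLin_q_p] }
  have hgen := eq_zero_of_isotropic_of_contraction B (fun w => sympLin_self (G w)) (m + 2)
    Finset.univ q p hfam η (fun w _ hw => by
      rw [hηv, hθ (fun i => G (w i)) hw, zero_sub, neg_eq_zero, Finset.sum_eq_zero, mul_zero]
      intro σ _
      rw [hM, mulBilin_apply, hw, mul_zero, mul_zero])
    (contraction_eq_zero η _ _ fun c => by
      simp only [hηe, hgc, Finset.sum_sub_distrib]
      rw [sub_eq_zero]
      exact (hε _).trans (hρ _).symm)
  have h := alternatingMap_eq_zero_of_span_eq_top (span_symplecticGens_eq_top G q p hq hp) η hgen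
    fun i => Pi.single (Sum.inr (Sum.inr i)) 1
  rw [hηe (fun i => Sum.inr (Sum.inr i)), sub_eq_zero] at h
  exact h

end Decomposition

/-- necessary condition for solvability of the strong inverse variational
problem: if the Euler–Lagrange equation of a first-order Lagrangian `L` coincides with the
Monge–Ampère equation of `ω` (via a nowhere-vanishing factor `k`), then the effective part
of `ω` satisfies `ω_ε = k·E(Lβ)`. -/
theorem inverse_problem_necessary_condition (n : ℕ) (hn : 2 ≤ n)
    (ω : Form (2 * n + 1) n) (hω : IsForm ω) (hωs : SmoothForm ω)
    (hχ : iprod (chi (n := n)) ω = 0)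
    (L : Vec (2 * n + 1) → ℝ) (hL : ContDiff ℝ (⊤ : ℕ∞) L)
    (k : Vec (2 * n + 1) → ℝ) (hk : ContDiff ℝ (⊤ : ℕ∞) k) (hk0 : ∀ x, k x ≠ 0)
    (hEL : ∀ φ : Vec n → ℝ, ContDiff ℝ (⊤ : ℕ∞) φ →
      pullback (jet φ) (ω - fsmul k (euler (fsmul L qvol))) = 0) :
    ∀ (ωε : Form (2 * n + 1) n) (x : Form (2 * n + 1) (n - 2)),
      iprod (chi (n := n)) ωε = 0 → botOp ωε = 0 → iprod (chi (n := n)) x = 0 →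
      ω = ωε + reindex (show n - 2 + 2 = n by omega) (wedge x (symp (n := n))) →
      ωε = fsmul k (euler (fsmul L qvol)) := by
  obtain ⟨m, rfl⟩ : ∃ m, n = m + 2 := ⟨n - 2, by omega⟩
  intro ωε x _ hbot _ hdec
  funext z v
  obtain ⟨α, hα⟩ := hω z
  set ρ := k z • eulerAlt (m := m + 1) L z with hρ
  have hρa : ∀ v, fsmul k (euler (fsmul L qvol)) z v = ρ v := fun v => by
    simp only [fsmul, hρ, AlternatingMap.smul_apply, smul_eq_mul]
    rw [← euler_eq_eulerAlt L hL]
  have hchi : ∀ (β : Vec (2 * (m + 2) + 1) [⋀^Fin (m + 2)]→ₗ[ℝ] ℝ),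
      (∀ w : Fin (m + 1) → Vec (2 * (m + 2) + 1), β (Fin.cons chi w) = 0) →
      ∀ v i, v i = chi → β v = 0 := by
    intro β hβ v i hi
    have h := β.map_perm v (Equiv.swap 0 i)
    rw [← Fin.cons_self_tail (v ∘ Equiv.swap 0 i)] at h
    simp only [Function.comp_apply, Equiv.swap_apply_left, hi] at h
    rw [hβ] at h
    rw [Units.smul_def, zsmul_eq_mul] at h
    exact (mul_eq_zero.1 h.symm).resolve_left (Int.cast_ne_zero.2 (Units.ne_zero _))
  have hθ := eq_zero_of_pullback_jet_eq_zero hEL (z := z) (θ := α - ρ)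
    (fun v => by
      rw [AlternatingMap.sub_apply, ← hρa, ← hα]
      rfl)
    (hchi _ fun w => by
      rw [AlternatingMap.sub_apply, ← hα, hρ, AlternatingMap.smul_apply, eulerAlt_chi L hL,
        smul_zero, sub_zero]
      exact congrFun (congrFun hχ z) w)
  rw [hρa]
  refine eq_of_lepage (ωε z) (x z) ρ (α - ρ) (((m.factorial * Nat.factorial 2 : ℕ) : ℝ)⁻¹)
    (fun v => ?_) (fun w => ?_) (fun w => ?_) hθ v
  · have h := congrFun (congrFun hdec z) v
    have h1 : ω z v = ωε z v + ((m.factorial * Nat.factorial 2 : ℕ) : ℝ)⁻¹ *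
        ∑ σ : Equiv.Perm (Fin (m + 2)), ((Equiv.Perm.sign σ : ℤ) : ℝ) *
          (x z fun i => v (σ (Fin.castAdd 2 i))) *
          symp z (fun j => v (σ (Fin.natAdd m j))) := h
    simp only [symp_eq] at h1
    rw [AlternatingMap.sub_apply, ← hα, h1, add_sub_cancel]
    exact (add_sub_cancel_right _ _).symm
  · exact (botOp_apply ωε z w).symm.trans (congrFun (congrFun hbot z) w)
  · simp only [hρ, AlternatingMap.smul_apply]
    rw [← Finset.smul_sum, eulerAlt_contraction L hL, smul_zero]

end MA
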